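/- Let m, n be positive integers, let 𝓘 and 𝓚 be homogeneous families (multisets) of corteges for m,n, and let α : 𝓘 → ℤ and β : 𝓚 → ℤ. If the quadruple (𝓘, 𝓚, α, β) is q-balanced, then for every field K, every nonzero element q of K, every associative unital K-algebra A, and every m×n q-matrix x with entries in A, the identity Σ_{(I|J,I'|J') ∈ 𝓘} q^{α(I|J,I'|J')} [I|J]·[I'|J'] = Σ_{(K|L,K'|L') ∈ 𝓚} q^{β(K|L,K'|L')} [K|L]·[K'|L'] holds in A (both sums taken with multiplicities). -/

import Mathlib

/-- Number of inversions of a permutation of `Fin k`. -/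
def permInversions {k : ℕ} (σ : Equiv.Perm (Fin k)) : ℕ :=
  (Finset.univ.filter (fun p : Fin k × Fin k => p.1 < p.2 ∧ σ p.2 < σ p.1)).card

/-- The quantum minor `[I|J]_q` of a matrix `x` (indexed by `ℕ`, rows/columns `1,…`),
with row set `I` and column set `J` (both listed in increasing order). -/
noncomputable def qMinor {K : Type} [Field K] {A : Type} [Ring A] [Algebra K A]
    (q : K) (x : ℕ → ℕ → A) (I J : Finset ℕ) : A :=
  if h : I.card = J.card then
    ∑ σ : Equiv.Perm (Fin I.card),
      ((-q) ^ permInversions σ) •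
        (List.ofFn (fun d : Fin I.card =>
          x (I.orderEmbOfFin rfl d) (J.orderEmbOfFin h.symm (σ d)))).prod
  else 0

/-- The flag quantum minor `[J]_q := [{1,…,|J|} | J]_q`. -/
noncomputable def flagMinor {K : Type} [Field K] {A : Type} [Ring A] [Algebra K A]
    (q : K) (x : ℕ → ℕ → A) (J : Finset ℕ) : A :=
  qMinor q x (Finset.Icc 1 J.card) J

/-- Manin's relations: `x` is an `m × n` `q`-matrix. -/
def IsQMatrix {K : Type} [Field K] {A : Type} [Ring A] [Algebra K A]
    (q : K) (m n : ℕ) (x : ℕ → ℕ → A) : Prop :=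
  (∀ i j k, 1 ≤ i → i ≤ m → 1 ≤ j → j < k → k ≤ n →
    x i j * x i k = q • (x i k * x i j)) ∧
  (∀ i l j, 1 ≤ i → i < l → l ≤ m → 1 ≤ j → j ≤ n →
    x i j * x l j = q • (x l j * x i j)) ∧
  (∀ i l j k, 1 ≤ i → i < l → l ≤ m → 1 ≤ j → j < k → k ≤ n →
    x i k * x l j = x l j * x i k) ∧
  (∀ i l j k, 1 ≤ i → i < l → l ≤ m → 1 ≤ j → j < k → k ≤ n →
    x i j * x l k - x l k * x i j = (q - q⁻¹) • (x i k * x l j))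

/-- A cortege `(I|J, I'|J')` for `m,n`. -/
structure Cortege (m n : ℕ) where
  I : Finset ℕ
  J : Finset ℕ
  I' : Finset ℕ
  J' : Finset ℕ
  hIm : I ⊆ Finset.Icc 1 m
  hI'm : I' ⊆ Finset.Icc 1 m
  hJn : J ⊆ Finset.Icc 1 n
  hJ'n : J' ⊆ Finset.Icc 1 n
  hIJ : I.card = J.card
  hI'J' : I'.card = J'.card

/-- Elements of the ground set `Y^r ⊔ Y^c`: `Sum.inl i` is a row index, `Sum.inr j`
a column index. -/
abbrev Elt := ℕ ⊕ ℕ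

/-- The linear order on `Y^r ⊔ Y^c`: rows in increasing order first, then columns
in decreasing order. -/
def cLT : Elt → Elt → Prop
  | Sum.inl i, Sum.inl i' => i < i'
  | Sum.inl _, Sum.inr _ => True
  | Sum.inr _, Sum.inl _ => False
  | Sum.inr j, Sum.inr j' => j' < j

instance : DecidableRel cLT := fun a b =>
  match a, b with
  | Sum.inl i, Sum.inl i' => inferInstanceAs (Decidable (i < i'))
  | Sum.inl _, Sum.inr _ => inferInstanceAs (Decidable True)
  | Sum.inr _, Sum.inl _ => inferInstanceAs (Decidable False)
  | Sum.inr j, Sum.inr j' => inferInstanceAs (Decidable (j' < j))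

/-- Two elements lie on the same side (both rows or both columns). -/
abbrev sameSide (a b : Elt) : Prop := a.isLeft = b.isLeft

/-- The underlying numerical index of an element. -/
abbrev eVal : Elt → ℕ := Sum.elim id id

/-- The numerically smaller member of a couple (used for couples lying in one side). -/
def numMin (p : Elt × Elt) : Elt := if eVal p.1 ≤ eVal p.2 then p.1 else p.2

namespace Cortege
variable {m n : ℕ}

/-- White elements of the refinement: `I° = I - I'` (rows) and `J° = J - J'` (columns). -/
def whites (S : Cortege m n) : Finset Elt :=
  (S.I \ S.I').image Sum.inl ∪ (S.J \ S.J').image Sum.inr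

/-- Black elements of the refinement: `I• = I' - I` (rows) and `J• = J' - J` (columns). -/
def blacks (S : Cortege m n) : Finset Elt :=
  (S.I' \ S.I).image Sum.inl ∪ (S.J' \ S.J).image Sum.inr

/-- The ground set `Y^r ⊔ Y^c` of a cortege. -/
def ground (S : Cortege m n) : Finset Elt := S.whites ∪ S.blacks

end Cortege

/-- `M` is a feasible matching for the cortege `S`.  Couples are stored as pairs
`(a, b)` with `a` preceding `b` in the linear order `cLT`. -/
def IsFeasible {m n : ℕ} (S : Cortege m n) (M : Finset (Elt × Elt)) : Prop :=
  (∀ p ∈ M, p.1 ∈ S.ground ∧ p.2 ∈ S.ground ∧ cLT p.1 p.2) ∧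
  (∀ y ∈ S.ground, ∃! p, p ∈ M ∧ (p.1 = y ∨ p.2 = y)) ∧
  (∀ p ∈ M, (sameSide p.1 p.2 → (p.1 ∈ S.whites ↔ p.2 ∈ S.blacks)) ∧
            (¬ sameSide p.1 p.2 → (p.1 ∈ S.whites ↔ p.2 ∈ S.whites))) ∧
  (∀ p ∈ M, ∀ p' ∈ M, ¬ (cLT p.1 p'.1 ∧ cLT p'.1 p.2 ∧ cLT p.2 p'.2))

/-- The set of elements covered by a set of couples. -/
def coveredBy (Φ : Finset (Elt × Elt)) : Finset Elt :=
  Φ.image Prod.fst ∪ Φ.image Prod.snd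

/-- `T` is obtained from `S` by the index exchange operation using the couples `Φ`:
the intersections and unions of the row (resp. column) sets are unchanged, and
the white/black color is flipped exactly on the elements covered by `Φ`. -/
def IsExchange {m n : ℕ} (S T : Cortege m n) (Φ : Finset (Elt × Elt)) : Prop :=
  S.I ∩ S.I' = T.I ∩ T.I' ∧ S.J ∩ S.J' = T.J ∩ T.J' ∧
  S.I ∪ S.I' = T.I ∪ T.I' ∧ S.J ∪ S.J' = T.J ∪ T.J' ∧
  ∀ a ∈ S.ground,
    (a ∈ coveredBy Φ → (a ∈ S.whites ↔ a ∈ T.blacks)) ∧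
    (a ∉ coveredBy Φ → (a ∈ S.whites ↔ a ∈ T.whites))

/-- The couples of `M` on which the white/black colorings of `S` and `T` differ. -/
def differSet {m n : ℕ} (S T : Cortege m n) (M : Finset (Elt × Elt)) :
    Finset (Elt × Elt) :=
  M.filter (fun p =>
    ¬ (p.1 ∈ S.whites ↔ p.1 ∈ T.whites) ∨ ¬ (p.2 ∈ S.whites ↔ p.2 ∈ T.whites))

/-- `ζ°(S;Φ)`: the number of couples of `Φ` lying within one side whose numerically
smaller element is white. -/
def zetaWhite {m n : ℕ} (S : Cortege m n) (Φ : Finset (Elt × Elt)) : ℕ :=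
  (Φ.filter (fun p => sameSide p.1 p.2 ∧ numMin p ∈ S.whites)).card

/-- `ζ•(S;Φ)`: the number of couples of `Φ` lying within one side whose numerically
smaller element is black. -/
def zetaBlack {m n : ℕ} (S : Cortege m n) (Φ : Finset (Elt × Elt)) : ℕ :=
  (Φ.filter (fun p => sameSide p.1 p.2 ∧ numMin p ∈ S.blacks)).card

/-- Configurations for an (indexed) family of corteges: pairs of a member of the family
and a feasible matching for it. -/
def Config {m n : ℕ} {ι : Type} (F : ι → Cortege m n) : Type :=
  {p : ι × Finset (Elt × Elt) // IsFeasible (F p.1) p.2}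

/-- The quadruple `(F, G, α, β)` is `q`-balanced. -/
def QBalanced {m n : ℕ} {ι κ : Type} (F : ι → Cortege m n) (G : κ → Cortege m n)
    (α : ι → ℤ) (β : κ → ℤ) : Prop :=
  ∃ γ : Config F ≃ Config G, ∀ c : Config F,
    ((γ c).1.2 = c.1.2) ∧
    IsExchange (F c.1.1) (G (γ c).1.1) (differSet (F c.1.1) (G (γ c).1.1) c.1.2) ∧
    β (γ c).1.1 - α c.1.1 =
      (zetaWhite (F c.1.1) (differSet (F c.1.1) (G (γ c).1.1) c.1.2) : ℤ) -
      (zetaBlack (F c.1.1) (differSet (F c.1.1) (G (γ c).1.1) c.1.2) : ℤ)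

/-- The two families `F`, `G` are (jointly) homogeneous. -/
def Homogeneous {m n : ℕ} {ι κ : Type} (F : ι → Cortege m n) (G : κ → Cortege m n) : Prop :=
  ∀ S T : Cortege m n,
    ((∃ i, F i = S) ∨ (∃ k, G k = S)) → ((∃ i, F i = T) ∨ (∃ k, G k = T)) →
    S.I ∪ S.I' = T.I ∪ T.I' ∧ S.I ∩ S.I' = T.I ∩ T.I' ∧
    S.J ∪ S.J' = T.J ∪ T.J' ∧ S.J ∩ S.J' = T.J ∩ T.J'

section PlanarMatching

variable {α : Type*}

/-- `PlanarMatching L M`: the multiset of couples `M` is a noncrossing perfect matching of the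
points listed, from left to right, in `L`. -/
inductive PlanarMatching : List α → Multiset (α × α) → Prop
  | nil : PlanarMatching [] 0
  | cup (L₁ L₂ : List α) (a b : α) (M : Multiset (α × α)) :
      PlanarMatching (L₁ ++ L₂) M → PlanarMatching (L₁ ++ a :: b :: L₂) ((a, b) ::ₘ M)

theorem append_pair_eq_append_pair {L₁ L₂ L₁' L₂' : List α} {a b c d : α}
    (h : L₁ ++ a :: b :: L₂ = L₁' ++ c :: d :: L₂') :
    (L₁ = L₁' ∧ a = c ∧ b = d ∧ L₂ = L₂') ∨
    (∃ X, L₁' = L₁ ++ a :: b :: X ∧ L₂ = X ++ c :: d :: L₂') ∨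
    (∃ X, L₁ = L₁' ++ c :: d :: X ∧ L₂' = X ++ a :: b :: L₂) ∨
    (b = c ∧ L₁' = L₁ ++ [a] ∧ L₂ = d :: L₂') ∨
    (a = d ∧ L₁ = L₁' ++ [c] ∧ L₂' = b :: L₂) := by
  rcases List.append_eq_append_iff.1 h with ⟨X, h1, h2⟩ | ⟨X, h1, h2⟩
  · rcases X with _ | ⟨x, _ | ⟨y, X⟩⟩ <;> simp_all
  · rcases X with _ | ⟨x, _ | ⟨y, X⟩⟩ <;> simp_all

namespace PlanarMatching

theorem map {β : Type*} (φ : α → β) {L : List α} {M : Multiset (α × α)}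
    (h : PlanarMatching L M) :
    PlanarMatching (L.map φ) (M.map (Prod.map φ φ)) := by
  induction h with
  | nil => exact nil
  | cup L₁ L₂ a b M _ ih =>
    rw [List.map_append] at ih
    simpa using cup _ _ (φ a) (φ b) _ ih

theorem mem_of_mem {L : List α} {M : Multiset (α × α)} (h : PlanarMatching L M) :
    ∀ p ∈ M, p.1 ∈ L ∧ p.2 ∈ L := by
  induction h with
  | nil => simp
  | cup L₁ L₂ a b M _ ih =>
    intro p hp
    rcases Multiset.mem_cons.1 hp with rfl | hp
    · simp
    · have := ih p hp
      simp only [List.mem_append, List.mem_cons] at this ⊢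
      tauto

theorem exists_mem_of_mem {L : List α} {M : Multiset (α × α)} (h : PlanarMatching L M) :
    ∀ x ∈ L, ∃ p ∈ M, p.1 = x ∨ p.2 = x := by
  induction h with
  | nil => simp
  | cup L₁ L₂ a b M _ ih =>
    intro x hx
    by_cases hxa : x = a
    · exact ⟨(a, b), by simp, Or.inl hxa.symm⟩
    by_cases hxb : x = b
    · exact ⟨(a, b), by simp, Or.inr hxb.symm⟩
    obtain ⟨p, hp, hpx⟩ := ih x (by simpa [hxa, hxb] using hx)
    exact ⟨p, by simp [hp], hpx⟩

/-- Summation over the points of `L` can be organised by couples. -/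
theorem sum_map {β : Type*} [AddCommMonoid β] (φ : α → β) {L : List α} {M : Multiset (α × α)}
    (h : PlanarMatching L M) :
    (L.map φ).sum = (M.map fun p => φ p.1 + φ p.2).sum := by
  induction h with
  | nil => simp
  | cup L₁ L₂ a b M _ ih =>
    simp only [List.map_append, List.sum_append, List.map_cons, List.sum_cons,
      Multiset.map_cons, Multiset.sum_cons] at ih ⊢
    rw [← ih]
    abel

theorem unique_of_nodup {L : List α} {M : Multiset (α × α)} (h : PlanarMatching L M)
    (hL : L.Nodup) :
    M.Nodup ∧ ∀ p ∈ M, ∀ p' ∈ M, ∀ x, (p.1 = x ∨ p.2 = x) → (p'.1 = x ∨ p'.2 = x) → p = p' := by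
  induction h with
  | nil => simp
  | cup L₁ L₂ a b M hM ih =>
    have hperm : (L₁ ++ a :: b :: L₂).Perm (a :: b :: (L₁ ++ L₂)) :=
      List.perm_middle.trans (List.perm_middle.cons a)
    have hnd := hperm.nodup_iff.1 hL
    simp only [List.nodup_cons, List.mem_cons, not_or] at hnd
    obtain ⟨⟨hab, ha⟩, hb, h0⟩ := hnd
    obtain ⟨ih1, ih2⟩ := ih h0
    have key : ∀ p ∈ M, ∀ x, (p.1 = x ∨ p.2 = x) → (a = x ∨ b = x) → False := by
      rintro p hp x (rfl | rfl) (rfl | rfl)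
      · exact ha (hM.mem_of_mem p hp).1
      · exact hb (hM.mem_of_mem p hp).1
      · exact ha (hM.mem_of_mem p hp).2
      · exact hb (hM.mem_of_mem p hp).2
    refine ⟨Multiset.nodup_cons.2 ⟨fun hm => ha (hM.mem_of_mem _ hm).1, ih1⟩, ?_⟩
    intro p hp p' hp' x hx hx'
    rcases Multiset.mem_cons.1 hp with rfl | hp <;> rcases Multiset.mem_cons.1 hp' with rfl | hp'
    · rfl
    · exact (key p' hp' x hx' hx).elim
    · exact (key p hp x hx hx').elim
    · exact ih2 p hp p' hp' x hx hx'

theorem noncrossing {r : α → α → Prop} (hr : ∀ a b, r a b → ¬ r b a) {L : List α}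
    {M : Multiset (α × α)} (h : PlanarMatching L M) (hL : L.Pairwise r) :
    (∀ p ∈ M, r p.1 p.2) ∧
      ∀ p ∈ M, ∀ p' ∈ M, ¬ (r p.1 p'.1 ∧ r p'.1 p.2 ∧ r p.2 p'.2) := by
  induction h with
  | nil => simp
  | cup L₁ L₂ a b M hM ih =>
    simp only [List.pairwise_append, List.pairwise_cons, List.mem_cons, forall_eq_or_imp] at hL
    obtain ⟨h1, ⟨⟨hab, ha⟩, hb, h2⟩, h12⟩ := hL
    obtain ⟨ih1, ih2⟩ := ih (List.pairwise_append.2 ⟨h1, h2, fun x hx y hy => (h12 x hx).2.2 y hy⟩)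
    have key : ∀ x ∈ L₁ ++ L₂, r a x → r x b → False := by
      intro x hx h3 h4
      rcases List.mem_append.1 hx with hx | hx
      · exact hr _ _ h3 (h12 x hx).1
      · exact hr _ _ h4 (hb x hx)
    refine ⟨?_, ?_⟩
    · intro p hp
      rcases Multiset.mem_cons.1 hp with rfl | hp
      · exact hab
      · exact ih1 p hp
    · rintro p hp p' hp' ⟨h3, h4, h5⟩
      rcases Multiset.mem_cons.1 hp with rfl | hp <;>
        rcases Multiset.mem_cons.1 hp' with rfl | hp'
      · exact hr _ _ h3 h3
      · exact key _ (hM.mem_of_mem p' hp').1 h3 h4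
      · exact key _ (hM.mem_of_mem p hp).2 h4 h5
      · exact ih2 p hp p' hp' ⟨h3, h4, h5⟩

/-- An adjacent opener-closer pair of a planar matching is one of its couples. -/
theorem exists_cons_of_adjacent {L : List α} {M : Multiset (α × α)} (h : PlanarMatching L M)
    {L₁ L₂ : List α} {a b : α} (hL : L = L₁ ++ a :: b :: L₂) {χ : α → Bool}
    (hχ : ∀ p ∈ M, χ p.1 = true ∧ χ p.2 = false) (ha : χ a = true) (hb : χ b = false) :
    ∃ M', M = (a, b) ::ₘ M' ∧ PlanarMatching (L₁ ++ L₂) M' := by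
  induction h generalizing L₁ L₂ with
  | nil => simp at hL
  | cup L₁' L₂' c d M hM ih =>
    have hcd := hχ (c, d) (by simp)
    have hχ' : ∀ p ∈ M, χ p.1 = true ∧ χ p.2 = false := fun p hp => hχ p (by simp [hp])
    rcases append_pair_eq_append_pair hL.symm with
      ⟨rfl, rfl, rfl, rfl⟩ | ⟨X, rfl, rfl⟩ | ⟨X, rfl, rfl⟩ | ⟨rfl, rfl, rfl⟩ | ⟨rfl, rfl, rfl⟩
    · exact ⟨M, rfl, hM⟩
    · obtain ⟨M', rfl, hM'⟩ := ih (L₁ := L₁) (L₂ := X ++ L₂') (by simp) hχ'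
      refine ⟨(c, d) ::ₘ M', Multiset.cons_swap _ _ _, ?_⟩
      rw [← List.append_assoc] at hM' ⊢
      exact cup _ _ _ _ _ hM'
    · obtain ⟨M', rfl, hM'⟩ := ih (L₁ := L₁' ++ X) (L₂ := L₂) (by simp) hχ'
      refine ⟨(c, d) ::ₘ M', Multiset.cons_swap _ _ _, ?_⟩
      rw [List.append_assoc] at hM' ⊢
      exact cup _ _ _ _ _ hM'
    · simp_all
    · simp_all

/-- A planar matching is determined by its set of openers. -/
theorem eq_of_openers {L : List α} {M M' : Multiset (α × α)} (h : PlanarMatching L M)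
    (h' : PlanarMatching L M') {χ : α → Bool}
    (hχ : ∀ p ∈ M, χ p.1 = true ∧ χ p.2 = false)
    (hχ' : ∀ p ∈ M', χ p.1 = true ∧ χ p.2 = false) : M' = M := by
  induction h generalizing M' with
  | nil =>
    generalize hL : ([] : List α) = L at h'
    cases h' with
    | nil => rfl
    | cup => simp at hL
  | cup L₁ L₂ a b M hM ih =>
    have hab := hχ (a, b) (by simp)
    obtain ⟨M'', rfl, hM''⟩ := h'.exists_cons_of_adjacent rfl hχ' hab.1 hab.2
    rw [ih hM'' (fun p hp => hχ p (by simp [hp])) (fun p hp => hχ' p (by simp [hp]))]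

end PlanarMatching

end PlanarMatching

section PlanarSpan

variable {α : Type*} {K : Type*} [Field K] {A : Type*} [AddCommGroup A] [Module K A]

/-- The weight of a single couple with colors `c`, `d`. -/
def cupWeight (q : K) (c d : Bool) : K := if c = d then 0 else if c then q else 1

@[simp] theorem cupWeight_self (q : K) (c : Bool) : cupWeight q c c = 0 := by simp [cupWeight]

@[simp] theorem cupWeight_true_false (q : K) : cupWeight q true false = q := by simp [cupWeight]

@[simp] theorem cupWeight_false_true (q : K) : cupWeight q false true = 1 := by simp [cupWeight]

/-- The weight of a matching with respect to a coloring. -/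
def matchWeight (q : K) (M : Multiset (α × α)) (χ : α → Bool) : K :=
  (M.map fun p => cupWeight q (χ p.1) (χ p.2)).prod

@[simp] theorem matchWeight_cons (q : K) (p : α × α) (M : Multiset (α × α)) (χ : α → Bool) :
    matchWeight q (p ::ₘ M) χ = cupWeight q (χ p.1) (χ p.2) * matchWeight q M χ := by
  simp [matchWeight]

theorem matchWeight_congr {q : K} {M : Multiset (α × α)} {χ χ' : α → Bool}
    (h : ∀ p ∈ M, χ p.1 = χ' p.1 ∧ χ p.2 = χ' p.2) : matchWeight q M χ = matchWeight q M χ' := by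
  unfold matchWeight
  rw [Multiset.map_congr rfl fun p hp => by rw [(h p hp).1, (h p hp).2]]

theorem PlanarMatching.matchWeight_congr {q : K} {L : List α} {M : Multiset (α × α)}
    (hM : PlanarMatching L M) {χ χ' : α → Bool} (h : ∀ x ∈ L, χ x = χ' x) :
    matchWeight q M χ = matchWeight q M χ' :=
  _root_.matchWeight_congr fun p hp =>
    ⟨h _ (hM.mem_of_mem p hp).1, h _ (hM.mem_of_mem p hp).2⟩

theorem matchWeight_map {β : Type*} (q : K) (φ : α → β) (M : Multiset (α × α)) (χ : β → Bool) :
    matchWeight q (M.map (Prod.map φ φ)) χ = matchWeight q M (χ ∘ φ) := by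
  simp [matchWeight]

theorem matchWeight_ne_zero_iff {q : K} (hq : q ≠ 0) {M : Multiset (α × α)} {χ : α → Bool} :
    matchWeight q M χ ≠ 0 ↔ ∀ p ∈ M, χ p.1 ≠ χ p.2 := by
  induction M using Multiset.induction_on with
  | empty => simp [matchWeight]
  | cons p M ih =>
    rw [matchWeight_cons, mul_ne_zero_iff, ih]
    simp only [Multiset.mem_cons, forall_eq_or_imp, and_congr_left_iff]
    intro _
    cases χ p.1 <;> cases χ p.2 <;> simp [hq]

/-- The `A`-valued functions of a coloring spanned by the weights of the planar matchings
of `L`. -/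
def planarSpan (q : K) (A : Type*) [AddCommGroup A] [Module K A] (L : List α) :
    Submodule K ((α → Bool) → A) :=
  Submodule.span K {Φ | ∃ M D, PlanarMatching L M ∧ Φ = fun χ => matchWeight q M χ • D}

theorem matchWeight_smul_mem_planarSpan {q : K} {L : List α} {M : Multiset (α × α)}
    (h : PlanarMatching L M) (D : A) : (fun χ => matchWeight q M χ • D) ∈ planarSpan q A L :=
  Submodule.subset_span ⟨M, D, h, rfl⟩

/-- A linear map sends `planarSpan` to a submodule if it does so for the generators. -/
theorem map_mem_of_mem_planarSpan {q : K} {L : List α} {V : Type*} [AddCommGroup V] [Module K V]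
    (T : ((α → Bool) → A) →ₗ[K] V) (P : Submodule K V)
    (h : ∀ M D, PlanarMatching L M → T (fun χ => matchWeight q M χ • D) ∈ P)
    {Φ : (α → Bool) → A} (hΦ : Φ ∈ planarSpan q A L) : T Φ ∈ P := by
  have : planarSpan q A L ≤ P.comap T := by
    refine Submodule.span_le.2 ?_
    rintro _ ⟨M, D, hM, rfl⟩
    exact h M D hM
  exact this hΦ

theorem comp_mem_planarSpan {β : Type*} {q : K} {L : List α} (φ : α → β) {Φ : (α → Bool) → A}
    (hΦ : Φ ∈ planarSpan q A L) : (fun χ => Φ (χ ∘ φ)) ∈ planarSpan q A (L.map φ) := by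
  refine map_mem_of_mem_planarSpan
    (LinearMap.funLeft K A fun χ : β → Bool => χ ∘ φ) _ (fun M D hM => ?_) hΦ
  have := matchWeight_smul_mem_planarSpan (q := q) (hM.map φ) D
  simp only [matchWeight_map] at this
  exact this

theorem linearMap_comp_mem_planarSpan {B : Type*} [AddCommGroup B] [Module K B] {q : K}
    {L : List α} (f : A →ₗ[K] B) {Φ : (α → Bool) → A} (hΦ : Φ ∈ planarSpan q A L) :
    (fun χ => f (Φ χ)) ∈ planarSpan q B L := by
  refine map_mem_of_mem_planarSpan (f.compLeft (α → Bool)) _ (fun M D hM => ?_) hΦ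
  convert matchWeight_smul_mem_planarSpan (q := q) hM (f D) using 1
  ext χ
  simp

theorem cup_mem_planarSpan {q : K} {L₁ L₂ : List α} (a b : α) {Φ : (α → Bool) → A}
    (hΦ : Φ ∈ planarSpan q A (L₁ ++ L₂)) :
    (fun χ => cupWeight q (χ a) (χ b) • Φ χ) ∈ planarSpan q A (L₁ ++ a :: b :: L₂) := by
  let T : ((α → Bool) → A) →ₗ[K] ((α → Bool) → A) :=
    { toFun := fun Φ χ => cupWeight q (χ a) (χ b) • Φ χ
      map_add' := fun _ _ => by ext; simp
      map_smul' := fun _ _ => by ext; simp [smul_smul, mul_comm] }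
  refine map_mem_of_mem_planarSpan T _ (fun M D hM => ?_) hΦ
  convert matchWeight_smul_mem_planarSpan (q := q) (hM.cup _ _ a b) D using 1
  ext χ
  simp [T, smul_smul]

variable [DecidableEq α]

/-- The coloring obtained from `χ` by giving `a` and `b` the colors `c` and `d`. -/
def recolor (χ : α → Bool) (a : α) (c : Bool) (b : α) (d : Bool) : α → Bool :=
  Function.update (Function.update χ a c) b d

theorem recolor_fst {χ : α → Bool} {a b : α} {c d : Bool} (h : a ≠ b) :
    recolor χ a c b d a = c := by simp [recolor, h]

@[simp] theorem recolor_snd {χ : α → Bool} {a b : α} {c d : Bool} :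
    recolor χ a c b d b = d := by simp [recolor]

theorem recolor_of_ne {χ : α → Bool} {a b x : α} {c d : Bool} (ha : x ≠ a) (hb : x ≠ b) :
    recolor χ a c b d x = χ x := by simp [recolor, ha, hb]

theorem recolor_self (χ : α → Bool) (a b : α) : recolor χ a (χ a) b (χ b) = χ := by
  simp [recolor]

/-- The contraction of the points `a` and `b`. -/
def capMap (q : K) (a b : α) : ((α → Bool) → A) →ₗ[K] ((α → Bool) → A) where
  toFun Φ χ := Φ (recolor χ a true b false) + q⁻¹ • Φ (recolor χ a false b true)
  map_add' Φ Ψ := by ext χ; simp; abel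
  map_smul' c Φ := by ext χ; simp [smul_comm c]

theorem PlanarMatching.exists_cap {q : K} (hq : q ≠ 0) {L : List α} {M : Multiset (α × α)}
    (h : PlanarMatching L M) {L₁ L₂ : List α} {a b : α} (hL : L = L₁ ++ a :: b :: L₂)
    (hnd : L.Nodup) :
    ∃ (s : K) (M' : Multiset (α × α)), PlanarMatching (L₁ ++ L₂) M' ∧ ∀ χ,
      matchWeight q M (recolor χ a true b false) +
        q⁻¹ * matchWeight q M (recolor χ a false b true) = s * matchWeight q M' χ := by
  induction h generalizing L₁ L₂ with
  | nil => simp at hL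
  | cup L₁' L₂' c d M hM ih =>
    have hnd' := hnd
    simp only [List.nodup_append, List.nodup_cons, List.mem_cons, not_or] at hnd'
    obtain ⟨-, ⟨⟨hcd, hc2⟩, hd2, -⟩, h12⟩ := hnd'
    have hcd0 : ∀ x ∈ L₁' ++ L₂', x ≠ c ∧ x ≠ d := by
      intro x hx
      rcases List.mem_append.1 hx with hx | hx
      · exact ⟨h12 x hx c (by simp), h12 x hx d (by simp)⟩
      · exact ⟨fun h => hc2 (h ▸ hx), fun h => hd2 (h ▸ hx)⟩
    have hnd0 : (L₁' ++ L₂').Nodup := hnd.sublist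
      ((List.Sublist.refl _).append
        ((List.sublist_cons_self _ _).trans (List.sublist_cons_self _ _)))
    rcases append_pair_eq_append_pair hL.symm with
      ⟨rfl, rfl, rfl, rfl⟩ | ⟨X, rfl, rfl⟩ | ⟨X, rfl, rfl⟩ | ⟨rfl, rfl, rfl⟩ | ⟨rfl, rfl, rfl⟩
    · refine ⟨q + q⁻¹, M, hM, fun χ => ?_⟩
      have h1 : ∀ e f, matchWeight q M (recolor χ a e b f) = matchWeight q M χ := fun e f =>
        hM.matchWeight_congr fun x hx => recolor_of_ne (hcd0 x hx).1 (hcd0 x hx).2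
      simp [h1, recolor_fst hcd]
      ring
    · obtain ⟨s, M', hM', hs⟩ := ih (L₁ := L₁) (L₂ := X ++ L₂') (by simp) hnd0
      refine ⟨s, (c, d) ::ₘ M', ?_, fun χ => ?_⟩
      · rw [← List.append_assoc] at hM' ⊢
        exact hM'.cup _ _ _ _ _
      · have ha := hcd0 a (by simp)
        have hb := hcd0 b (by simp)
        simp only [matchWeight_cons, recolor_of_ne ha.1.symm hb.1.symm,
          recolor_of_ne ha.2.symm hb.2.symm]
        linear_combination cupWeight q (χ c) (χ d) * hs χ
    · obtain ⟨s, M', hM', hs⟩ := ih (L₁ := L₁' ++ X) (L₂ := L₂) (by simp) hnd0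
      refine ⟨s, (c, d) ::ₘ M', ?_, fun χ => ?_⟩
      · rw [List.append_assoc] at hM' ⊢
        exact hM'.cup _ _ _ _ _
      · have ha := hcd0 a (by simp)
        have hb := hcd0 b (by simp)
        simp only [matchWeight_cons, recolor_of_ne ha.1.symm hb.1.symm,
          recolor_of_ne ha.2.symm hb.2.symm]
        linear_combination cupWeight q (χ c) (χ d) * hs χ
    · have hab : a ≠ b := (hcd0 a (by simp)).1
      have had : a ≠ d := (hcd0 a (by simp)).2
      have hrel : ∀ x ∈ L₁ ++ L₂', x ≠ a := by
        have : (L₁ ++ a :: L₂').Nodup := by simpa using hnd0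
        have := (List.nodup_middle.1 this)
        intro x hx hxa
        exact (List.nodup_cons.1 this).1 (hxa ▸ hx)
      refine ⟨1, M.map (Prod.map (Function.update id a d) (Function.update id a d)), ?_,
        fun χ => ?_⟩
      · have := hM.map (Function.update id a d)
        have hid : ∀ l : List α, (∀ x ∈ l, x ≠ a) → l.map (Function.update id a d) = l := by
          intro l hl
          conv_rhs => rw [← List.map_id l]
          exact List.map_congr_left fun x hx => by simp [hl x hx]
        simpa [hid L₁ fun x hx => hrel x (by simp [hx]),
          hid L₂' fun x hx => hrel x (by simp [hx])] using this
      · have key : ∀ e f, χ d = e → matchWeight q M (recolor χ a e b f) =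
            matchWeight q M (χ ∘ Function.update id a d) := by
          intro e f he
          refine hM.matchWeight_congr fun x hx => ?_
          by_cases hxa : x = a
          · subst hxa; simp [recolor_fst hab, he]
          · simp [hxa, recolor_of_ne hxa (hcd0 x hx).1]
        rw [matchWeight_map]
        simp only [matchWeight_cons, recolor_snd, recolor_of_ne had.symm (Ne.symm hcd)]
        cases hd : χ d
        · rw [key false true hd]; simp [hq]
        · rw [key true false hd]; simp
    · have hab : b ≠ a := (hcd0 b (by simp)).2
      have hbc : b ≠ c := (hcd0 b (by simp)).1
      have hrel : ∀ x ∈ L₁' ++ L₂, x ≠ b := by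
        have := (List.nodup_middle.1 hnd0)
        intro x hx hxa
        exact (List.nodup_cons.1 this).1 (hxa ▸ hx)
      refine ⟨1, M.map (Prod.map (Function.update id b c) (Function.update id b c)), ?_,
        fun χ => ?_⟩
      · have := hM.map (Function.update id b c)
        have hid : ∀ l : List α, (∀ x ∈ l, x ≠ b) → l.map (Function.update id b c) = l := by
          intro l hl
          conv_rhs => rw [← List.map_id l]
          exact List.map_congr_left fun x hx => by simp [hl x hx]
        simpa [hid L₁' fun x hx => hrel x (by simp [hx]),
          hid L₂ fun x hx => hrel x (by simp [hx])] using this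
      · have key : ∀ e f, χ c = f → matchWeight q M (recolor χ a e b f) =
            matchWeight q M (χ ∘ Function.update id b c) := by
          intro e f he
          refine hM.matchWeight_congr fun x hx => ?_
          by_cases hxa : x = b
          · subst hxa; simp [he]
          · simp [hxa, recolor_of_ne (hcd0 x hx).2 hxa]
        rw [matchWeight_map]
        simp only [matchWeight_cons, recolor_fst hab.symm, recolor_of_ne hcd hbc.symm]
        cases hd : χ c
        · rw [key true false hd]; simp
        · rw [key false true hd]; simp [hq]

theorem capMap_mem_planarSpan {q : K} (hq : q ≠ 0) {L₁ L₂ : List α} {a b : α}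
    (hnd : (L₁ ++ a :: b :: L₂).Nodup) {Φ : (α → Bool) → A}
    (hΦ : Φ ∈ planarSpan q A (L₁ ++ a :: b :: L₂)) :
    capMap q a b Φ ∈ planarSpan q A (L₁ ++ L₂) := by
  refine map_mem_of_mem_planarSpan _ _ (fun M D hM => ?_) hΦ
  obtain ⟨s, M', hM', hs⟩ := hM.exists_cap hq rfl hnd
  convert (planarSpan q A (L₁ ++ L₂)).smul_mem s (matchWeight_smul_mem_planarSpan hM' D) using 1
  ext χ
  simp only [capMap, LinearMap.coe_mk, AddHom.coe_mk, Pi.smul_apply, smul_smul, ← add_smul, hs]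

end PlanarSpan

section Removal

variable {α : Type*} [DecidableEq α]

theorem List.Nodup.pairwise_idxOf_lt {L : List α} (h : L.Nodup) :
    L.Pairwise fun x y => L.idxOf x < L.idxOf y := by
  rw [List.pairwise_iff_getElem]
  intro i j hi hj hij
  rwa [h.idxOf_getElem, h.idxOf_getElem]

open Classical in
/-- The coloring in which exactly the openers of `M` are `true`. -/
noncomputable def openerColoring (M : Multiset (α × α)) (z : α) : Bool := decide (∃ p ∈ M, p.1 = z)

namespace PlanarMatching

variable {L : List α} {M : Multiset (α × α)}

theorem idxOf_lt (h : PlanarMatching L M) (hL : L.Nodup) :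
    ∀ p ∈ M, L.idxOf p.1 < L.idxOf p.2 :=
  (h.noncrossing (r := fun x y => L.idxOf x < L.idxOf y) (fun _ _ h => h.not_gt)
    hL.pairwise_idxOf_lt).1

theorem openerColoring_eq (h : PlanarMatching L M) (hL : L.Nodup) :
    ∀ p ∈ M, openerColoring M p.1 = true ∧ openerColoring M p.2 = false := by
  intro p hp
  refine ⟨by simpa [openerColoring] using ⟨p.2, hp⟩, ?_⟩
  simp only [openerColoring, decide_eq_false_iff_not, not_exists, not_and]
  intro p' hp' h'
  have := (h.unique_of_nodup hL).2 p hp p' hp' p.2 (Or.inr rfl) (Or.inl h')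
  subst this
  have := h.idxOf_lt hL _ hp
  rw [h'] at this
  exact this.false

/-- Total index of the openers. -/
def openerSum (L : List α) (M : Multiset (α × α)) : ℕ := (M.map fun p => L.idxOf p.1).sum

/-- Total index of the points colored `true`. -/
def colorSum (L : List α) (χ : α → Bool) : ℕ := (L.map fun z => if χ z then L.idxOf z else 0).sum

theorem openerSum_le (h : PlanarMatching L M) (hL : L.Nodup) {χ : α → Bool}
    (hχ : ∀ p ∈ M, χ p.1 ≠ χ p.2) : openerSum L M ≤ colorSum L χ := by
  unfold openerSum colorSum
  rw [h.sum_map]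
  refine Multiset.sum_map_le_sum_map _ _ fun p hp => ?_
  have h1 := h.idxOf_lt hL p hp
  have h2 := hχ p hp
  revert h2
  cases χ p.1 <;> cases χ p.2 <;> simp
  exact h1.le

theorem openers_of_colorSum_le (h : PlanarMatching L M) (hL : L.Nodup) {χ : α → Bool}
    (hχ : ∀ p ∈ M, χ p.1 ≠ χ p.2) (hs : colorSum L χ ≤ openerSum L M) :
    ∀ p ∈ M, χ p.1 = true ∧ χ p.2 = false := by
  by_contra! hc
  obtain ⟨p, hp, hpc⟩ := hc
  refine hs.not_gt ?_
  unfold openerSum colorSum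
  rw [h.sum_map]
  refine Multiset.sum_lt_sum (fun p hp => ?_) ⟨p, hp, ?_⟩
  · have h1 := h.idxOf_lt hL p hp
    have h2 := hχ p hp
    revert h2
    cases χ p.1 <;> cases χ p.2 <;> simp
    exact h1.le
  · have h1 := h.idxOf_lt hL p hp
    have h2 := hχ p hp
    revert h2 hpc
    cases χ p.1 <;> cases χ p.2 <;> simp
    exact h1

theorem colorSum_of_openers (h : PlanarMatching L M) {χ : α → Bool}
    (hχ : ∀ p ∈ M, χ p.1 = true ∧ χ p.2 = false) : colorSum L χ = openerSum L M := by
  unfold openerSum colorSum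
  rw [h.sum_map]
  congr 1
  refine Multiset.map_congr rfl fun p hp => ?_
  simp [hχ p hp]

end PlanarMatching

theorem colorSum_recolor_lt {L₁ L₂ : List α} {a b : α} (hL : (L₁ ++ a :: b :: L₂).Nodup)
    {χ : α → Bool} (ha : χ a = false) (hb : χ b = true) :
    PlanarMatching.colorSum (L₁ ++ a :: b :: L₂) (recolor χ a true b false) <
      PlanarMatching.colorSum (L₁ ++ a :: b :: L₂) χ := by
  have hlt : (L₁ ++ a :: b :: L₂).idxOf a < (L₁ ++ a :: b :: L₂).idxOf b := by
    have := List.pairwise_append.1 hL.pairwise_idxOf_lt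
    exact (List.pairwise_cons.1 this.2.1).1 b (by simp)
  have hL' := hL
  simp only [List.nodup_append, List.nodup_cons, List.mem_cons, not_or] at hL'
  obtain ⟨-, ⟨⟨hab, ha2⟩, hb2, -⟩, h12⟩ := hL'
  unfold PlanarMatching.colorSum
  generalize hidx : (fun z => (L₁ ++ a :: b :: L₂).idxOf z) = idx at *
  have hi : ∀ z, (L₁ ++ a :: b :: L₂).idxOf z = idx z := fun z => congrFun hidx z
  simp only [hi] at hlt ⊢
  have e1 : ∀ z ∈ L₁, (if recolor χ a true b false z then idx z else 0) =
      if χ z then idx z else 0 := fun z hz => by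
    rw [recolor_of_ne (h12 z hz a (by simp)) (h12 z hz b (by simp))]
  have e2 : ∀ z ∈ L₂, (if recolor χ a true b false z then idx z else 0) =
      if χ z then idx z else 0 := fun z hz => by
    rw [recolor_of_ne (ne_of_mem_of_not_mem hz ha2) (ne_of_mem_of_not_mem hz hb2)]
  simp only [List.map_append, List.map_cons, List.sum_append, List.sum_cons,
    List.map_congr_left e1, List.map_congr_left e2, recolor_fst hab, recolor_snd, ha, hb]
  simpa using hlt

variable {K : Type*} [Field K] {A : Type*} [AddCommGroup A] [Module K A]

theorem exists_finsupp_of_mem_planarSpan {q : K} {L : List α} {Φ : (α → Bool) → A}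
    (hΦ : Φ ∈ planarSpan q A L) :
    ∃ D : Multiset (α × α) →₀ A, (∀ M ∈ D.support, PlanarMatching L M) ∧
      ∀ χ, Φ χ = D.sum fun M d => matchWeight q M χ • d := by
  classical
  induction hΦ using Submodule.span_induction with
  | mem Φ h =>
    obtain ⟨M, D, hM, rfl⟩ := h
    refine ⟨Finsupp.single M D, fun M' hM' => ?_, fun χ => by simp⟩
    have := Finsupp.support_single_subset hM'
    rw [Finset.mem_singleton.1 this]
    exact hM
  | zero => exact ⟨0, by simp, by simp⟩
  | add Φ Ψ _ _ ih1 ih2 =>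
    obtain ⟨D, hD, hΦ⟩ := ih1
    obtain ⟨E, hE, hΨ⟩ := ih2
    refine ⟨D + E, fun M hM => ?_, fun χ => ?_⟩
    · rcases Finset.mem_union.1 (Finsupp.support_add hM) with h | h
      · exact hD M h
      · exact hE M h
    · rw [Finsupp.sum_add_index' (by simp) (by simp [smul_add]), Pi.add_apply, hΦ, hΨ]
  | smul c Φ _ ih =>
    obtain ⟨D, hD, hΦ⟩ := ih
    refine ⟨c • D, fun M hM => hD M (Finsupp.support_smul hM), fun χ => ?_⟩
    rw [Finsupp.sum_smul_index' (by simp), Pi.smul_apply, hΦ, Finsupp.smul_sum]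
    simp only [smul_comm c]

/-- If `Φ` behaves in the adjacent points `a`, `b` like a function with a common factor
`cupWeight q (χ a) (χ b)`, then that factor can be removed. -/
theorem removal_mem_planarSpan {q : K} (hq : q ≠ 0) {L₁ L₂ : List α} {a b : α}
    (hnd : (L₁ ++ a :: b :: L₂).Nodup) {Φ : (α → Bool) → A}
    (hΦ : Φ ∈ planarSpan q A (L₁ ++ a :: b :: L₂))
    (h0 : ∀ χ, χ a = χ b → Φ χ = 0)
    (h1 : ∀ χ, Φ (recolor χ a true b false) = q • Φ (recolor χ a false b true)) :
    (fun χ => Φ (recolor χ a false b true)) ∈ planarSpan q A (L₁ ++ L₂) := by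
  classical
  obtain ⟨D, hD, hDΦ⟩ := exists_finsupp_of_mem_planarSpan hΦ
  set L := L₁ ++ a :: b :: L₂ with hL
  have hab : a ≠ b := by
    have := (List.nodup_append.1 hnd).2.1
    simp only [List.nodup_cons, List.mem_cons, not_or] at this
    exact this.1.1
  have weight_mem : ∀ M ∈ D.support, (a, b) ∈ M → ∃ M', M = (a, b) ::ₘ M' ∧
      PlanarMatching (L₁ ++ L₂) M' := by
    intro M hM hmem
    have := (hD M hM).openerColoring_eq hnd
    exact (hD M hM).exists_cons_of_adjacent rfl this (this _ hmem).1 (this _ hmem).2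
  have weight_zero : ∀ M ∈ D.support, ∀ χ, χ a = χ b → (a, b) ∈ M → matchWeight q M χ = 0 := by
    intro M hM χ hχ hmem
    by_contra hne
    exact (matchWeight_ne_zero_iff hq).1 hne _ hmem hχ
  have all_mem : ∀ M ∈ D.support, (a, b) ∈ M := by
    by_contra! hbad
    let B := D.support.filter fun M => (a, b) ∉ M
    obtain ⟨M₀, hM₀, hmin⟩ := B.exists_min_image (PlanarMatching.openerSum L)
      (by obtain ⟨M, hM, hM'⟩ := hbad; exact ⟨M, by simpa [B, hM'] using hM⟩)
    obtain ⟨hM₀, hab₀⟩ := Finset.mem_filter.1 hM₀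
    have hPM := hD M₀ hM₀
    set χ := openerColoring M₀ with hχdef
    have hχ : ∀ p ∈ M₀, χ p.1 = true ∧ χ p.2 = false := hPM.openerColoring_eq hnd
    have hcs : PlanarMatching.colorSum L χ = PlanarMatching.openerSum L M₀ :=
      hPM.colorSum_of_openers hχ
    have other : ∀ M ∈ D.support, (a, b) ∉ M → M ≠ M₀ → matchWeight q M χ = 0 := by
      intro M hM hMab hne
      by_contra hw
      have hw := (matchWeight_ne_zero_iff hq).1 hw
      refine hne (hPM.eq_of_openers (hD M hM) hχ
        ((hD M hM).openers_of_colorSum_le hnd hw ?_))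
      rw [hcs]
      exact hmin M (Finset.mem_filter.2 ⟨hM, hMab⟩)
    have hself : matchWeight q M₀ χ ≠ 0 := (matchWeight_ne_zero_iff hq).2 fun p hp => by
      rw [(hχ p hp).1, (hχ p hp).2]; simp
    have hD₀ : D M₀ ≠ 0 := Finsupp.mem_support_iff.1 hM₀
    by_cases hcc : χ a = χ b
    · have := h0 χ hcc
      rw [hDΦ, Finsupp.sum, Finset.sum_eq_single_of_mem M₀ hM₀] at this
      · exact smul_ne_zero hself hD₀ this
      · intro M hM hne
        by_cases hMab : (a, b) ∈ M
        · rw [weight_zero M hM χ hcc hMab, zero_smul]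
        · rw [other M hM hMab hne, zero_smul]
    · by_cases hca : χ a = true
      · have hcb : χ b = false := by
          rw [hca] at hcc; cases h : χ b <;> simp_all
        obtain ⟨M', rfl, -⟩ := hPM.exists_cons_of_adjacent rfl hχ hca hcb
        exact hab₀ (by simp)
      · have hca : χ a = false := by simpa using hca
        have hcb : χ b = true := by
          rw [hca] at hcc; cases h : χ b <;> simp_all
        have h2 := h1 χ
        have hre : recolor χ a false b true = χ := by
          conv_rhs => rw [← recolor_self χ a b, hca, hcb]
        rw [hre, ← sub_eq_zero, hDΦ, hDΦ, Finsupp.smul_sum, Finsupp.sum, Finsupp.sum,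
          ← Finset.sum_sub_distrib, Finset.sum_eq_single_of_mem M₀ hM₀] at h2
        · have : matchWeight q M₀ (recolor χ a true b false) = 0 := by
            by_contra hw
            have h3 := hPM.openerSum_le hnd ((matchWeight_ne_zero_iff hq).1 hw)
            have h4 := colorSum_recolor_lt hnd hca hcb
            rw [← hL] at h4
            omega
          rw [this, zero_smul, zero_sub, neg_eq_zero] at h2
          exact smul_ne_zero hq (smul_ne_zero hself hD₀) h2
        · intro M hM hne
          by_cases hMab : (a, b) ∈ M
          · obtain ⟨M', rfl, hM'⟩ := weight_mem M hM hMab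
            have : matchWeight q M' (recolor χ a true b false) = matchWeight q M' χ := by
              refine hM'.matchWeight_congr fun x hx => ?_
              have h5 := (List.perm_middle.trans (List.perm_middle.cons a)).nodup_iff.1 hnd
              simp only [List.nodup_cons, List.mem_cons, not_or] at h5
              exact recolor_of_ne (ne_of_mem_of_not_mem hx h5.1.2) (ne_of_mem_of_not_mem hx h5.2.1)
            simp [this, recolor_fst hab, hca, hcb, smul_smul]
          · have : matchWeight q M (recolor χ a true b false) = 0 := by
              by_contra hw
              have h3 := (hD M hM).openerSum_le hnd ((matchWeight_ne_zero_iff hq).1 hw)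
              have h4 := colorSum_recolor_lt hnd hca hcb
              have h5 := hmin M (Finset.mem_filter.2 ⟨hM, hMab⟩)
              rw [← hL] at h4
              omega
            rw [this, other M hM hMab hne]
            simp
  have : (fun χ => Φ (recolor χ a false b true)) =
      ∑ M ∈ D.support, fun χ => matchWeight q M (recolor χ a false b true) • D M := by
    ext χ
    rw [hDΦ, Finsupp.sum, Finset.sum_apply]
  rw [this]
  refine Submodule.sum_mem _ fun M hM => ?_
  obtain ⟨M', rfl, hM'⟩ := weight_mem M hM (all_mem M hM)
  convert matchWeight_smul_mem_planarSpan (q := q) hM' (D ((a, b) ::ₘ M')) using 1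
  ext χ
  have : matchWeight q M' (recolor χ a false b true) = matchWeight q M' χ := by
    refine hM'.matchWeight_congr fun x hx => ?_
    have h5 := (List.perm_middle.trans (List.perm_middle.cons a)).nodup_iff.1 hnd
    simp only [List.nodup_cons, List.mem_cons, not_or] at h5
    exact recolor_of_ne (ne_of_mem_of_not_mem hx h5.1.2) (ne_of_mem_of_not_mem hx h5.2.1)
  simp [this, recolor_fst hab]

end Removal

section Braid

variable {α : Type*} [DecidableEq α] {K : Type*} [Field K] {A : Type*} [AddCommGroup A] [Module K A]

/-- The operator moving the point `k` to the right across the point `c`. -/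
def crossing (q : K) (k c : α) (h : (α → Bool) → A) (χ : α → Bool) : A :=
  if χ k = χ c then (-q) • h χ else if χ c then h χ
  else h χ - (q - q⁻¹) • h (recolor χ k false c true)

theorem recolor_eq_comp_swap {χ : α → Bool} {k c : α} (hkc : k ≠ c) :
    recolor χ k (χ c) c (χ k) = χ ∘ Equiv.swap k c := by
  ext x
  by_cases hx : x = c
  · subst hx; simp
  by_cases hx' : x = k
  · subst hx'; simp [recolor_fst hkc]
  simp [recolor_of_ne hx' hx, Equiv.swap_apply_of_ne_of_ne hx' hx]

theorem crossing_mem_planarSpan {q : K} (hq : q ≠ 0) {L₁ L₂ : List α} {k c : α}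
    (hnd : (L₁ ++ k :: c :: L₂).Nodup) {h : (α → Bool) → A}
    (hh : h ∈ planarSpan q A (L₁ ++ k :: c :: L₂)) :
    crossing q k c h ∈ planarSpan q A (L₁ ++ c :: k :: L₂) := by
  have h5 := (List.perm_middle.trans (List.perm_middle.cons k)).nodup_iff.1 hnd
  simp only [List.nodup_cons, List.mem_cons, not_or, List.mem_append] at h5
  obtain ⟨⟨hkc, hk1, hk2⟩, ⟨hc1, hc2⟩, -⟩ := h5
  have h1 := comp_mem_planarSpan (Equiv.swap k c) hh
  have hmap : ∀ l : List α, k ∉ l → c ∉ l → l.map (Equiv.swap k c) = l := by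
    intro l hk hc
    conv_rhs => rw [← List.map_id l]
    exact List.map_congr_left fun x hx =>
      Equiv.swap_apply_of_ne_of_ne (ne_of_mem_of_not_mem hx hk) (ne_of_mem_of_not_mem hx hc)
  simp only [List.map_append, List.map_cons, hmap L₁ hk1 hc1, hmap L₂ hk2 hc2,
    Equiv.swap_apply_left, Equiv.swap_apply_right] at h1
  have h2 := cup_mem_planarSpan c k (capMap_mem_planarSpan hq hnd hh)
  convert Submodule.add_mem _ (Submodule.smul_mem _ (-q) h1) h2 using 1
  ext χ
  have e1 := recolor_eq_comp_swap (χ := χ) hkc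
  have e2 := recolor_self χ k c
  cases hk : χ k <;> cases hc : χ c <;>
    simp only [hk, hc] at e1 e2 <;>
    simp [crossing, hk, hc, capMap, ← e1, e2, smul_smul, hq]
  module

/-- The labels of the columns in `C`, in decreasing order. -/
def colList (C : Finset ℕ) : List (ℕ ⊕ ℕ) := (C.sort (· ≥ ·)).map Sum.inr

@[simp] theorem mem_colList {C : Finset ℕ} {z : ℕ ⊕ ℕ} :
    z ∈ colList C ↔ ∃ c ∈ C, Sum.inr c = z := by
  simp [colList]

@[simp] theorem colList_empty : colList ∅ = [] := by simp [colList]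

theorem colList_insert {C : Finset ℕ} {c : ℕ} (h : ∀ x ∈ C, x < c) :
    colList (insert c C) = Sum.inr c :: colList C := by
  rw [colList, Finset.sort_insert _ (fun b hb => (h b hb).le) (fun hc => (h c hc).false)]
  rfl

theorem colList_union {C D : Finset ℕ} (h : ∀ c ∈ C, ∀ d ∈ D, d < c) :
    colList (C ∪ D) = colList C ++ colList D := by
  induction C using Finset.induction_on_max with
  | empty => simp
  | insert a C ha ih =>
    rw [Finset.insert_union, colList_insert, colList_insert ha, ih, List.cons_append]
    · exact fun c hc d hd => h c (Finset.mem_insert_of_mem hc) d hd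
    · intro x hx
      rcases Finset.mem_union.1 hx with hx | hx
      · exact ha x hx
      · exact h a (Finset.mem_insert_self _ _) x hx

theorem colList_eq_of_mem {C : Finset ℕ} {k : ℕ} (hk : k ∈ C) :
    colList C = colList (C.filter (k < ·)) ++ Sum.inr k :: colList (C.filter (· < k)) := by
  rw [← colList_insert (by simp), ← colList_union]
  · congr 1; ext x; simp; grind
  · simp; grind

theorem colList_erase {C : Finset ℕ} {k : ℕ} :
    colList (C.erase k) = colList (C.filter (k < ·)) ++ colList (C.filter (· < k)) := by
  rw [← colList_union]
  · congr 1; ext x; simp; grind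
  · simp; grind

/-- The operator moving the point `k` to the right across the columns of `C`. -/
def braid (q : K) (k : ℕ ⊕ ℕ) (C : Finset ℕ) (h : (ℕ ⊕ ℕ → Bool) → A) (χ : ℕ ⊕ ℕ → Bool) : A :=
  if χ k then
    (-q) ^ (C.filter fun c => χ (.inr c) = true).card • h χ -
      (q - q⁻¹) • ∑ j ∈ C.filter (fun j => χ (.inr j) = false),
        (-q) ^ ((C.filter fun c => j < c ∧ χ (.inr c) = false).card +
          (C.filter fun c => c < j ∧ χ (.inr c) = true).card) •
            h (recolor χ k false (.inr j) true)
  else (-q) ^ (C.filter fun c => χ (.inr c) = false).card • h χ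

theorem braid_mem_planarSpan {q : K} (hq : q ≠ 0) {k : ℕ ⊕ ℕ} {C : Finset ℕ}
    {L₁ L₂ : List (ℕ ⊕ ℕ)} (hnd : (L₁ ++ k :: (colList C ++ L₂)).Nodup)
    {h : (ℕ ⊕ ℕ → Bool) → A} (hh : h ∈ planarSpan q A (L₁ ++ k :: (colList C ++ L₂))) :
    braid q k C h ∈ planarSpan q A (L₁ ++ (colList C ++ k :: L₂)) := by
  induction C using Finset.induction_on_max generalizing L₁ h with
  | empty =>
    have e : braid q k ∅ h = h := by
      ext χ
      simp [braid]
    simpa [e] using hh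
  | insert c C hc ih =>
    rw [colList_insert hc, List.cons_append] at hnd hh ⊢
    have hkc : k ≠ .inr c := by
      have := (List.nodup_append.1 hnd).2.1
      simp only [List.nodup_cons, List.mem_cons, not_or] at this
      exact this.1.1
    have hcC : c ∉ C := fun h => (hc c h).false
    have h1 := crossing_mem_planarSpan hq hnd hh
    have hnd1 : (L₁ ++ .inr c :: k :: (colList C ++ L₂)).Nodup :=
      (((List.Perm.swap _ _ _).append_left L₁).nodup_iff).1 hnd
    have := ih (L₁ := L₁ ++ [.inr c]) (h := crossing q k (.inr c) h) (by simpa using hnd1)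
      (by simpa using h1)
    have e : braid q k (insert c C) h = braid q k C (crossing q k (.inr c) h) := by
      ext χ
      have hne : ∀ j ∈ C, c ≠ j := fun j hj => (hc j hj).ne'
      have hrec : ∀ j ∈ C, recolor χ k false (.inr j) true (.inr c) = χ (.inr c) := fun j hj =>
        recolor_of_ne hkc.symm (by simpa using hne j hj)
      have hreck : ∀ j : ℕ, k ≠ .inr j → recolor χ k false (.inr j) true k = false := fun j hj =>
        recolor_fst hj
      have hkj : ∀ j ∈ C, k ≠ .inr j := by
        rintro j hj rfl
        have := (List.nodup_append.1 hnd).2.1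
        simp only [List.nodup_cons] at this
        exact this.1 (by simp [hj])
      cases hk : χ k
      · simp only [braid, hk, crossing, Finset.filter_insert]
        cases hχc : χ (.inr c)
        · simp [hcC, pow_succ, smul_smul]
        · simp
      · have hsum : ∀ (e : ℕ → ℕ),
            ∑ j ∈ C.filter (fun j => χ (.inr j) = false), (-q) ^ e j •
              crossing q k (.inr c) h (recolor χ k false (.inr j) true) =
            ∑ j ∈ C.filter (fun j => χ (.inr j) = false),
              (-q) ^ (e j + if χ (.inr c) = false then 1 else 0) •
                h (recolor χ k false (.inr j) true) := by
          intro e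
          refine Finset.sum_congr rfl fun j hj => ?_
          have hj := (Finset.mem_filter.1 hj).1
          simp only [crossing, hreck j (hkj j hj), hrec j hj]
          cases χ (.inr c) <;> simp [pow_succ, smul_smul]
        have hlow : ∀ j ∈ C, ∀ p : ℕ → Prop, ∀ [DecidablePred p],
            ((insert c C).filter fun c => c < j ∧ p c) =
            C.filter fun c => c < j ∧ p c := by
          intro j hj p _
          rw [Finset.filter_insert, if_neg]
          exact fun h => (h.1.trans (hc j hj)).false
        have hhigh : ∀ j ∈ C, ((insert c C).filter fun c => j < c ∧ χ (.inr c) = false).card =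
            (C.filter fun c => j < c ∧ χ (.inr c) = false).card +
              if χ (.inr c) = false then 1 else 0 := by
          intro j hj
          rw [Finset.filter_insert]
          split_ifs with h1 h2 h2
          · rw [Finset.card_insert_of_notMem (by simp [hcC])]
          · exact absurd h1.2 h2
          · exact absurd ⟨hc j hj, h2⟩ h1
          · rfl
        simp only [braid, hk, if_true, hsum]
        cases hχc : χ (.inr c)
        · rw [Finset.filter_insert, if_neg (by simp [hχc]), Finset.filter_insert, if_pos hχc,
            Finset.sum_insert (by simp [hcC])]
          have hs : ∑ j ∈ C.filter (fun j => χ (.inr j) = false),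
              (-q) ^ (((insert c C).filter fun c => j < c ∧ χ (.inr c) = false).card +
                ((insert c C).filter fun c => c < j ∧ χ (.inr c) = true).card) •
                h (recolor χ k false (.inr j) true) =
              ∑ j ∈ C.filter (fun j => χ (.inr j) = false),
              (-q) ^ ((C.filter fun c => j < c ∧ χ (.inr c) = false).card +
                (C.filter fun c => c < j ∧ χ (.inr c) = true).card + 1) •
                h (recolor χ k false (.inr j) true) := by
            refine Finset.sum_congr rfl fun j hj => ?_
            have hj := (Finset.mem_filter.1 hj).1
            rw [hhigh j hj, hlow j hj, if_pos hχc]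
            congr 2
            ring
          have hc1 : ((insert c C).filter fun x => c < x ∧ χ (.inr x) = false) = ∅ := by
            ext x; simp; grind
          have hc2 : ((insert c C).filter fun x => x < c ∧ χ (.inr x) = true) =
              C.filter fun x => χ (.inr x) = true := by
            ext x; simp; grind
          rw [hs, hc1, hc2]
          simp only [crossing, hk, hχc, Finset.card_empty, zero_add, if_true]
          simp only [Bool.true_eq_false, Bool.false_eq_true, if_false]
          module
        · have hs : ∑ j ∈ C.filter (fun j => χ (.inr j) = false),
              (-q) ^ (((insert c C).filter fun c => j < c ∧ χ (.inr c) = false).card +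
                ((insert c C).filter fun c => c < j ∧ χ (.inr c) = true).card) •
                h (recolor χ k false (.inr j) true) =
              ∑ j ∈ C.filter (fun j => χ (.inr j) = false),
              (-q) ^ ((C.filter fun c => j < c ∧ χ (.inr c) = false).card +
                (C.filter fun c => c < j ∧ χ (.inr c) = true).card) •
                h (recolor χ k false (.inr j) true) := by
            refine Finset.sum_congr rfl fun j hj => ?_
            have hj := (Finset.mem_filter.1 hj).1
            rw [hhigh j hj, hlow j hj]
            simp [hχc]
          have hf : (insert c C).filter (fun j => χ (.inr j) = false) =
              C.filter (fun j => χ (.inr j) = false) := by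
            rw [Finset.filter_insert, if_neg (by simp [hχc])]
          have ht : ((insert c C).filter (fun j => χ (.inr j) = true)).card =
              (C.filter (fun j => χ (.inr j) = true)).card + 1 := by
            rw [Finset.filter_insert, if_pos hχc, Finset.card_insert_of_notMem (by simp [hcC])]
          rw [hf, hs, ht]
          simp [crossing, hk, hχc, pow_succ, smul_smul]
    simpa [e] using this

end Braid

section RowStep

variable {K : Type*} [Field K] {A : Type*} [AddCommGroup A] [Module K A]

/-- The operator creating a cup with left end `ν` and moving its right end `k` across the
columns of `C`. -/
def cupBraid (q : K) (ν k : ℕ ⊕ ℕ) (C : Finset ℕ) (f : (ℕ ⊕ ℕ → Bool) → A) :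
    (ℕ ⊕ ℕ → Bool) → A :=
  braid q k C fun χ => cupWeight q (χ ν) (χ k) • f χ

theorem cupBraid_mem_planarSpan {q : K} (hq : q ≠ 0) {ν k : ℕ ⊕ ℕ} {C : Finset ℕ}
    {L₁ L₂ : List (ℕ ⊕ ℕ)} (hnd : (L₁ ++ ν :: k :: (colList C ++ L₂)).Nodup)
    {f : (ℕ ⊕ ℕ → Bool) → A} (hf : f ∈ planarSpan q A (L₁ ++ (colList C ++ L₂))) :
    cupBraid q ν k C f ∈ planarSpan q A (L₁ ++ ν :: (colList C ++ k :: L₂)) := by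
  have := braid_mem_planarSpan hq (L₁ := L₁ ++ [ν]) (k := k) (C := C) (L₂ := L₂)
    (by simpa using hnd) (by simpa using cup_mem_planarSpan ν k hf)
  simpa [cupBraid] using this

theorem cupBraid_of_false {q : K} {ν : ℕ} {k : ℕ} {C : Finset ℕ} {f : (ℕ ⊕ ℕ → Bool) → A}
    {χ : ℕ ⊕ ℕ → Bool} (hk : k ∉ C) (hν : χ (.inl ν) = false) :
    cupBraid q (.inl ν) (.inr k) C f χ =
      if χ (.inr k) then (-q) ^ (C.filter fun c => χ (.inr c) = true).card • f χ else 0 := by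
  unfold cupBraid braid
  have : ∀ j ∈ C, recolor χ (.inr k) false (.inr j) true (.inr k) = false := fun j hj =>
    recolor_fst (by rintro ⟨rfl⟩; exact hk hj)
  have h2 : ∀ j, recolor χ (.inr k) false (.inr j) true (.inl ν) = χ (.inl ν) := fun j =>
    recolor_of_ne (by simp) (by simp)
  rw [Finset.sum_eq_zero]
  · split_ifs with h <;> simp [h, hν]
  · intro j hj
    simp [h2, hν, this j (Finset.mem_filter.1 hj).1]

theorem cupBraid_of_true {q : K} {ν : ℕ} {k : ℕ} {C : Finset ℕ} {f : (ℕ ⊕ ℕ → Bool) → A}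
    {χ : ℕ ⊕ ℕ → Bool} (hk : k ∉ C) (hν : χ (.inl ν) = true) :
    cupBraid q (.inl ν) (.inr k) C f χ =
      if χ (.inr k) then -(q - q⁻¹) • q • ∑ j ∈ C.filter (fun j => χ (.inr j) = false),
        (-q) ^ ((C.filter fun c => j < c ∧ χ (.inr c) = false).card +
          (C.filter fun c => c < j ∧ χ (.inr c) = true).card) •
            f (recolor χ (.inr k) false (.inr j) true)
      else q • (-q) ^ (C.filter fun c => χ (.inr c) = false).card • f χ := by
  unfold cupBraid braid
  have : ∀ j ∈ C, recolor χ (.inr k) false (.inr j) true (.inr k) = false := fun j hj =>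
    recolor_fst (by rintro ⟨rfl⟩; exact hk hj)
  have h2 : ∀ j, recolor χ (.inr k) false (.inr j) true (.inl ν) = χ (.inl ν) := fun j =>
    recolor_of_ne (by simp) (by simp)
  dsimp only
  split_ifs with h
  · rw [h, hν]
    simp only [cupWeight_self, zero_smul, smul_zero, zero_sub, neg_smul, Finset.smul_sum]
    rw [← Finset.sum_neg_distrib]
    refine Finset.sum_congr rfl fun j hj => ?_
    rw [h2, hν, this j (Finset.mem_filter.1 hj).1, cupWeight_true_false, smul_comm q]
  · have h : χ (.inr k) = false := by simpa using h
    rw [h, hν, cupWeight_true_false, smul_comm q]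

/-- The columns of `D` together with the columns of `Y` having color `b`. -/
def colsOf (Y D : Finset ℕ) (χ : ℕ ⊕ ℕ → Bool) (b : Bool) : Finset ℕ :=
  Y.filter (fun j => χ (.inr j) = b) ∪ D

theorem mem_colsOf {Y D : Finset ℕ} {χ : ℕ ⊕ ℕ → Bool} {b : Bool} {j : ℕ} :
    j ∈ colsOf Y D χ b ↔ (j ∈ Y ∧ χ (.inr j) = b) ∨ j ∈ D := by
  simp [colsOf]

theorem card_filter_colsOf {Y D : Finset ℕ} (h : Disjoint Y D) (χ : ℕ ⊕ ℕ → Bool) (b : Bool)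
    (p : ℕ → Prop) [DecidablePred p] :
    ((colsOf Y D χ b).filter p).card =
      (Y.filter fun j => p j ∧ χ (.inr j) = b).card + (D.filter p).card := by
  rw [colsOf, Finset.filter_union, Finset.card_union_of_disjoint, Finset.filter_filter]
  · simp only [and_comm]
  · exact Finset.disjoint_filter_filter
      (Finset.disjoint_of_subset_left (Finset.filter_subset _ _) h)

/-- The coefficient of the entry `v k` in the expansion of a product of two quantum minors along
a row common to the first (`b = true`) or the second (`b = false`) minor. -/
def rowCoeff (q : K) (H : Finset ℕ → Finset ℕ → A) (b : Bool) (J J' : Finset ℕ) (k : ℕ) : A :=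
  if b then
    (if k ∈ J then (q * (-q) ^ (J.filter (k < ·)).card * if k ∈ J' then q⁻¹ else 1) •
      H (J.erase k) J' else 0) -
    if k ∈ J' then ((q - q⁻¹) * q) • ∑ j ∈ (J \ J').filter (k < ·),
      (-q) ^ ((J.filter (j < ·)).card + (J'.filter fun t => k < t ∧ t < j).card) •
        H (J.erase j) (insert j (J'.erase k)) else 0
  else if k ∈ J' then (-q) ^ (J'.filter (k < ·)).card • H J (J'.erase k) else 0

/-- A family of functions of pairs of column sets and a row coloring is planar if all its
restrictions to the colorings of given rows and columns are. -/
def IsPlanarFamily (q : K) (R : List ℕ) (H : Finset ℕ → Finset ℕ → (ℕ → Bool) → A) : Prop :=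
  ∀ Y D : Finset ℕ, Disjoint Y D →
    (fun χ : ℕ ⊕ ℕ → Bool => H (colsOf Y D χ false) (colsOf Y D χ true) fun i => χ (.inl i)) ∈
      planarSpan q A (R.map Sum.inl ++ colList Y)

theorem nodup_rows_append_columns {R : List ℕ} {C : List ℕ} (hR : R.Nodup) (hC : C.Nodup) :
    (R.map (Sum.inl : ℕ → ℕ ⊕ ℕ) ++ C.map Sum.inr).Nodup :=
  List.nodup_append.2 ⟨hR.map Sum.inl_injective, hC.map Sum.inr_injective, by simp⟩

variable {q : K} {R : List ℕ} {H : Finset ℕ → Finset ℕ → (ℕ → Bool) → A}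

theorem rowCoeff_exponent {Y D : Finset ℕ} (hYD : Disjoint Y D) (χ : ℕ ⊕ ℕ → Bool) {j k : ℕ}
    (hj : j ∈ Y) (hkj : k < j) :
    ((colsOf Y D χ false).filter (j < ·)).card +
        ((colsOf Y D χ true).filter fun t => k < t ∧ t < j).card =
      (D.filter (k < ·)).card +
        (((Y.filter (k < ·)).filter fun c => j < c ∧ χ (.inr c) = false).card +
          ((Y.filter (k < ·)).filter fun c => c < j ∧ χ (.inr c) = true).card) := by
  have hjD : j ∉ D := Finset.disjoint_left.1 hYD hj
  rw [card_filter_colsOf hYD, card_filter_colsOf hYD]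
  have e1 : (Y.filter (k < ·)).filter (fun c => j < c ∧ χ (.inr c) = false) =
      Y.filter fun c => j < c ∧ χ (.inr c) = false := by
    ext c; simp; grind
  have e2 : (Y.filter (k < ·)).filter (fun c => c < j ∧ χ (.inr c) = true) =
      Y.filter fun c => (k < c ∧ c < j) ∧ χ (.inr c) = true := by
    ext c; simp; grind
  have e3 : D.filter (k < ·) = D.filter (j < ·) ∪ D.filter fun t => k < t ∧ t < j := by
    ext c; simp; grind
  have e4 : Disjoint (D.filter (j < ·)) (D.filter fun t => k < t ∧ t < j) :=
    Finset.disjoint_filter.2 fun c _ h => by omega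
  rw [e1, e2, e3, Finset.card_union_of_disjoint e4]
  ring

theorem rowCoeff_mem_planarSpan_of_mem (hq : q ≠ 0) (hR : R.Nodup) (hH : IsPlanarFamily q R H)
    {ν : ℕ} (hν : ν ∉ R) {Y D : Finset ℕ} (hYD : Disjoint Y D) {k : ℕ} (hk : k ∈ Y) :
    (fun χ : ℕ ⊕ ℕ → Bool => rowCoeff q (fun J J' => H J J' fun i => χ (.inl i)) (χ (.inl ν))
      (colsOf Y D χ false) (colsOf Y D χ true) k) ∈
      planarSpan q A ((R ++ [ν]).map Sum.inl ++ colList Y) := by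
  have hkD : k ∉ D := Finset.disjoint_left.1 hYD hk
  have h0 := hH (Y.erase k) D (Finset.disjoint_of_subset_left (Finset.erase_subset _ _) hYD)
  set f := fun χ : ℕ ⊕ ℕ → Bool =>
    H (colsOf (Y.erase k) D χ false) (colsOf (Y.erase k) D χ true) fun i => χ (.inl i) with hf
  rw [colList_erase] at h0
  have hnd : ((R ++ [ν]).map Sum.inl ++ colList Y).Nodup :=
    nodup_rows_append_columns (List.nodup_append.2 ⟨hR, by simp, by grind⟩) (Finset.sort_nodup _ _)
  have h1 := cupBraid_mem_planarSpan (ν := .inl ν) (k := .inr k) hq (by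
    rw [colList_eq_of_mem hk] at hnd
    have : (List.map (Sum.inl : ℕ → ℕ ⊕ ℕ) R ++ .inl ν :: .inr k ::
      (colList (Y.filter (k < ·)) ++ colList (Y.filter (· < k)))).Perm
      (List.map Sum.inl (R ++ [ν]) ++ (colList (Y.filter (k < ·)) ++
        .inr k :: colList (Y.filter (· < k)))) := by
      simpa using (List.perm_middle.symm.cons _).append_left _
    exact this.nodup_iff.2 hnd) h0
  rw [← colList_eq_of_mem hk] at h1
  have h2 := Submodule.smul_mem _ ((-q) ^ (D.filter (k < ·)).card) h1
  convert h2 using 1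
  · simp
  · ext χ
    have hkC : k ∉ Y.filter (k < ·) := by simp
    have ec : ∀ b, χ (.inr k) ≠ b → colsOf (Y.erase k) D χ b = colsOf Y D χ b := by
      intro b hb; ext c; simp only [mem_colsOf, Finset.mem_erase]; grind
    have ec' : ∀ b, χ (.inr k) = b → colsOf (Y.erase k) D χ b = (colsOf Y D χ b).erase k := by
      intro b hb; ext c; simp only [mem_colsOf, Finset.mem_erase]; grind
    have ecard : ∀ b, ((Y.filter (k < ·)).filter fun c => χ (.inr c) = b).card +
        (D.filter (k < ·)).card = ((colsOf Y D χ b).filter (k < ·)).card := by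
      intro b; rw [card_filter_colsOf hYD, Finset.filter_filter]
    have hmem : ∀ b, k ∈ colsOf Y D χ b ↔ χ (.inr k) = b := by
      intro b; simp [mem_colsOf, hk, hkD]
    rw [Pi.smul_apply]
    cases hχν : χ (.inl ν)
    · rw [cupBraid_of_false hkC hχν]
      cases hχk : χ (.inr k)
      · simp [rowCoeff, hmem, hχk]
      · simp only [rowCoeff, hmem, hχk, hf, ec false (by simp [hχk]), ec' true hχk, ← ecard]
        simp [smul_smul, pow_add, mul_comm]
    · rw [cupBraid_of_true hkC hχν]
      cases hχk : χ (.inr k)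
      · simp only [rowCoeff, hmem, hχk, hf, ec true (by simp [hχk]), ec' false hχk, ← ecard]
        simp only [if_true, if_false, reduceCtorEq, sub_zero, smul_smul, mul_one]
        congr 1
        simp only [pow_add]
        ring
      · simp only [rowCoeff, hmem, hχk]
        simp only [if_true, if_false, reduceCtorEq, zero_sub, Finset.smul_sum,
          ← Finset.sum_neg_distrib, neg_smul, smul_neg]
        have es : (Y.filter (k < ·)).filter (fun j => χ (.inr j) = false) =
            (colsOf Y D χ false \ colsOf Y D χ true).filter (k < ·) := by
          ext c
          have : c ∈ Y → c ∉ D := fun h => Finset.disjoint_left.1 hYD h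
          simp only [Finset.mem_filter, Finset.mem_sdiff, mem_colsOf]
          cases χ (.inr c) <;> grind
        rw [← es]
        refine Finset.sum_congr rfl fun j hj => ?_
        simp only [Finset.mem_filter] at hj
        obtain ⟨⟨hjY, hkj⟩, hχj⟩ := hj
        have hjD : j ∉ D := Finset.disjoint_left.1 hYD hjY
        rw [rowCoeff_exponent hYD χ hjY hkj]
        have e1 : colsOf (Y.erase k) D (recolor χ (.inr k) false (.inr j) true) false =
            (colsOf Y D χ false).erase j := by
          ext c
          simp only [mem_colsOf, Finset.mem_erase, recolor, Function.update_apply]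
          grind
        have e2 : colsOf (Y.erase k) D (recolor χ (.inr k) false (.inr j) true) true =
            insert j ((colsOf Y D χ true).erase k) := by
          ext c
          simp only [mem_colsOf, Finset.mem_erase, recolor, Function.update_apply,
            Finset.mem_insert]
          grind
        have e3 : ∀ i, recolor χ (.inr k) false (.inr j) true (.inl i) = χ (.inl i) := fun i =>
          recolor_of_ne (by simp) (by simp)
        simp only [hf, e1, e2, e3, smul_smul]
        congr 2
        simp only [pow_add]
        ring

theorem rowCoeff_mem_planarSpan_of_mem_common (hq : q ≠ 0) (hR : R.Nodup)
    (hH : IsPlanarFamily q R H) {ν : ℕ} (hν : ν ∉ R) {Y D : Finset ℕ} (hYD : Disjoint Y D) {k : ℕ}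
    (hk : k ∈ D) :
    (fun χ : ℕ ⊕ ℕ → Bool => rowCoeff q (fun J J' => H J J' fun i => χ (.inl i)) (χ (.inl ν))
      (colsOf Y D χ false) (colsOf Y D χ true) k) ∈
      planarSpan q A ((R ++ [ν]).map Sum.inl ++ colList Y) := by
  have hkY : k ∉ Y := Finset.disjoint_right.1 hYD hk
  obtain ⟨s, hs⟩ := Infinite.exists_notMem_finset (Y ∪ D)
  simp only [Finset.mem_union, not_or] at hs
  have hsk : s ≠ k := fun h => hs.2 (h ▸ hk)
  have hdisj : Disjoint (insert k Y) (D.erase k) := by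
    rw [Finset.disjoint_left] at hYD ⊢
    intro a ha ha'
    grind
  have h0 := hH (insert k Y) (D.erase k) hdisj
  set f := fun χ : ℕ ⊕ ℕ → Bool => H (colsOf (insert k Y) (D.erase k) χ false)
    (colsOf (insert k Y) (D.erase k) χ true) fun i => χ (.inl i) with hf
  have eC : (insert k Y).filter (k < ·) = Y.filter (k < ·) := by
    rw [Finset.filter_insert, if_neg (lt_irrefl k)]
  have eC' : (insert k Y).filter (· < k) = Y.filter (· < k) := by
    rw [Finset.filter_insert, if_neg (lt_irrefl k)]
  rw [colList_eq_of_mem (Finset.mem_insert_self k Y), eC, eC'] at h0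
  have hnd : (List.map (Sum.inl : ℕ → ℕ ⊕ ℕ) R ++ .inl ν :: .inr s ::
      (colList (Y.filter (k < ·)) ++ .inr k :: colList (Y.filter (· < k)))).Nodup := by
    have := nodup_rows_append_columns (R := R ++ [ν]) (C := s :: (insert k Y).sort (· ≥ ·))
      (List.nodup_append.2 ⟨hR, by simp, by grind⟩)
      (List.nodup_cons.2 ⟨by simp [hsk, hs.1], Finset.sort_nodup _ _⟩)
    rw [List.map_cons] at this
    change (_ ++ Sum.inr s :: colList (insert k Y)).Nodup at this
    rw [colList_eq_of_mem (Finset.mem_insert_self k Y), eC, eC'] at this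
    simpa using this
  have h1 := cupBraid_mem_planarSpan hq hnd h0
  have hnd' : ((List.map (Sum.inl : ℕ → ℕ ⊕ ℕ) R ++ .inl ν :: colList (Y.filter (k < ·))) ++
      .inr s :: .inr k :: colList (Y.filter (· < k))).Nodup := by
    refine (List.Perm.nodup_iff ?_).1 hnd
    simpa using (List.perm_middle.symm.cons (Sum.inl ν)).append_left (R.map Sum.inl)
  have h2 := capMap_mem_planarSpan hq hnd'
    (Φ := cupBraid q (.inl ν) (.inr s) (Y.filter (k < ·)) f) (by simpa using h1)
  have h3 := Submodule.smul_mem _ ((-q) ^ (D.filter (k < ·)).card) h2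
  convert h3 using 1
  · conv_lhs => rw [← Finset.erase_eq_of_notMem hkY, colList_erase]
    simp
  · ext χ
    have hsC : s ∉ Y.filter (k < ·) := by simp [hs.1]
    have ecard : ∀ b, ((Y.filter (k < ·)).filter fun c => χ (.inr c) = b).card +
        (D.filter (k < ·)).card = ((colsOf Y D χ b).filter (k < ·)).card := by
      intro b; rw [card_filter_colsOf hYD, Finset.filter_filter]
    have hmem : ∀ b, k ∈ colsOf Y D χ b := by
      intro b; simp [mem_colsOf, hk]
    have hrl : ∀ (a b : ℕ) (c d : Bool) (χ : ℕ ⊕ ℕ → Bool) (i : ℕ),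
        recolor χ (.inr a) c (.inr b) d (.inl i) = χ (.inl i) := fun a b c d χ i =>
      recolor_of_ne (by simp) (by simp)
    have hrs : ∀ c d, recolor χ (.inr s) c (.inr k) d (.inr s) = c := fun c d =>
      recolor_fst (by simpa using hsk)
    have hrC : ∀ e d, ∀ c ∈ Y, recolor χ (.inr s) e (.inr k) d (.inr c) = χ (.inr c) :=
      fun e d c hc => recolor_of_ne (by rintro ⟨rfl⟩; exact hs.1 hc) (by rintro ⟨rfl⟩; exact hkY hc)
    have hfilt : ∀ e d b, ((Y.filter (k < ·)).filter
        fun c => recolor χ (.inr s) e (.inr k) d (.inr c) = b) =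
        (Y.filter (k < ·)).filter fun c => χ (.inr c) = b := fun e d b =>
      Finset.filter_congr fun c hc => by rw [hrC e d c (Finset.mem_filter.1 hc).1]
    have hfilt' : ∀ e d b (p : ℕ → Prop) [DecidablePred p], ((Y.filter (k < ·)).filter
        fun c => p c ∧ recolor χ (.inr s) e (.inr k) d (.inr c) = b) =
        (Y.filter (k < ·)).filter fun c => p c ∧ χ (.inr c) = b := fun e d b p _ =>
      Finset.filter_congr fun c hc => by rw [hrC e d c (Finset.mem_filter.1 hc).1]
    have ecol : ∀ e d b, colsOf (insert k Y) (D.erase k) (recolor χ (.inr s) e (.inr k) d) b =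
        if d = b then colsOf Y D χ b else (colsOf Y D χ b).erase k := by
      intro e d b
      ext c
      have h4 : c ∈ Y → c ≠ s ∧ c ≠ k := fun hc =>
        ⟨ne_of_mem_of_not_mem hc hs.1, ne_of_mem_of_not_mem hc hkY⟩
      split_ifs with hdb <;>
        simp only [mem_colsOf, Finset.mem_erase, Finset.mem_insert, recolor, Function.update_apply,
          Sum.inr.injEq] <;>
        grind
    rw [Pi.smul_apply]
    simp only [capMap, LinearMap.coe_mk, AddHom.coe_mk]
    cases hχν : χ (.inl ν)
    · rw [cupBraid_of_false hsC (by simpa [hrl] using hχν),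
        cupBraid_of_false hsC (by simpa [hrl] using hχν)]
      simp only [hrs, hfilt, hf, ecol, hrl, rowCoeff, hmem, ← ecard]
      simp [smul_smul, pow_add, mul_comm]
    · rw [cupBraid_of_true hsC (by simpa [hrl] using hχν),
        cupBraid_of_true hsC (by simpa [hrl] using hχν)]
      simp only [hrs, hfilt, hfilt', if_true, Bool.false_eq_true, if_false, rowCoeff, hmem]
      have es : (Y.filter (k < ·)).filter (fun j => χ (.inr j) = false) =
          (colsOf Y D χ false \ colsOf Y D χ true).filter (k < ·) := by
        ext c
        have : c ∈ Y → c ∉ D := fun h => Finset.disjoint_left.1 hYD h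
        simp only [Finset.mem_filter, Finset.mem_sdiff, mem_colsOf]
        cases χ (.inr c) <;> grind
      rw [← es, add_comm, smul_add, sub_eq_add_neg]
      congr 1
      · simp only [hf, ecol, hrl, ← ecard, smul_smul]
        simp only [Bool.true_eq_false, if_true, if_false]
        congr 1
        simp only [pow_add]
        field_simp
      · simp only [Finset.smul_sum, ← Finset.sum_neg_distrib, neg_smul, smul_neg]
        refine Finset.sum_congr rfl fun j hj => ?_
        simp only [Finset.mem_filter] at hj
        obtain ⟨⟨hjY, hkj⟩, hχj⟩ := hj
        have hjD : j ∉ D := Finset.disjoint_left.1 hYD hjY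
        rw [rowCoeff_exponent hYD χ hjY hkj]
        have e1 : colsOf (insert k Y) (D.erase k)
            (recolor (recolor χ (.inr s) true (.inr k) false) (.inr s) false (.inr j) true) false =
            (colsOf Y D χ false).erase j := by
          ext c
          simp only [mem_colsOf, Finset.mem_erase, Finset.mem_insert, recolor,
            Function.update_apply, Sum.inr.injEq]
          grind
        have e2 : colsOf (insert k Y) (D.erase k)
            (recolor (recolor χ (.inr s) true (.inr k) false) (.inr s) false (.inr j) true) true =
            insert j ((colsOf Y D χ true).erase k) := by
          ext c
          simp only [mem_colsOf, Finset.mem_erase, recolor, Function.update_apply,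
            Finset.mem_insert, Sum.inr.injEq]
          grind
        simp only [hf, e1, e2, hrl, smul_smul]
        congr 2
        simp only [pow_add]
        ring

end RowStep

section RowExpansion

variable {K : Type*} [Field K] {A : Type*} [Ring A] [Algebra K A]

/-- The value of `v j * G J` when `v` is a row below the rows of the quantum minors `G J`. -/
def moveRight (q : K) (G : Finset ℕ → A) (v : ℕ → A) (j : ℕ) (J : Finset ℕ) : A :=
  if j ∈ J then q⁻¹ • (G J * v j)
  else G J * v j - (q - q⁻¹) • ∑ k ∈ J.filter (· < j),
    (-q) ^ (J.filter fun t => k < t ∧ t < j).card • (G (insert j (J.erase k)) * v k)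

/-- Expansion of a quantum minor along its last row `v`. -/
def rowExpand (q : K) (G : Finset ℕ → A) (v : ℕ → A) (J : Finset ℕ) : A :=
  ∑ k ∈ J, (-q) ^ (J.filter (k < ·)).card • (G (J.erase k) * v k)

theorem sum_rowCoeff_false (q : K) (H : Finset ℕ → Finset ℕ → A) (v : ℕ → A) (J J' : Finset ℕ) :
    ∑ k ∈ J ∪ J', rowCoeff q H false J J' k * v k = rowExpand q (H J) v J' := by
  simp only [rowCoeff, rowExpand, Bool.false_eq_true, if_false, ite_mul, zero_mul,
    smul_mul_assoc]
  rw [← Finset.sum_filter]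
  congr 1
  ext k
  simp

theorem sum_rowCoeff_true (q : K) (H : Finset ℕ → Finset ℕ → A) (v : ℕ → A) (J J' : Finset ℕ) :
    ∑ k ∈ J ∪ J', rowCoeff q H true J J' k * v k =
      q • ∑ j ∈ J, (-q) ^ (J.filter (j < ·)).card • moveRight q (H (J.erase j)) v j J' := by
  simp only [rowCoeff, if_true, sub_mul, ite_mul, zero_mul, smul_mul_assoc]
  rw [Finset.sum_sub_distrib, ← Finset.sum_filter, ← Finset.sum_filter]
  have e1 : (J ∪ J').filter (· ∈ J) = J := by ext; simp
  have e2 : (J ∪ J').filter (· ∈ J') = J' := by ext; simp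
  rw [e1, e2]
  have h : ∀ j ∈ J, moveRight q (H (J.erase j)) v j J' =
      (if j ∈ J' then q⁻¹ else 1 : K) • (H (J.erase j) J' * v j) -
      if j ∈ J' then 0 else (q - q⁻¹) • ∑ k ∈ J'.filter (· < j),
        (-q) ^ (J'.filter fun t => k < t ∧ t < j).card •
          (H (J.erase j) (insert j (J'.erase k)) * v k) := by
    intro j _
    unfold moveRight
    split_ifs <;> simp
  rw [show ∑ j ∈ J, (-q) ^ (J.filter (j < ·)).card • moveRight q (H (J.erase j)) v j J' = _ from
    Finset.sum_congr rfl fun j hj => by rw [h j hj]]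
  simp only [smul_sub, Finset.sum_sub_distrib]
  congr 1
  · rw [Finset.smul_sum]
    exact Finset.sum_congr rfl fun k _ => by simp only [smul_smul, mul_assoc]
  · simp only [smul_ite, smul_zero]
    rw [Finset.sum_ite, Finset.sum_const_zero, zero_add]
    simp only [Finset.smul_sum, Finset.sum_mul, smul_mul_assoc, smul_smul]
    rw [Finset.sum_comm' (t' := J') (s' := fun k => (J \ J').filter (k < ·))
      (s := J.filter (· ∉ J')) (t := fun j => J'.filter (· < j))]
    · refine Finset.sum_congr rfl fun k hk => Finset.sum_congr rfl fun j hj => ?_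
      congr 1
      rw [pow_add]
      ring
    · intro j k
      simp
      tauto

theorem IsPlanarFamily.step {q : K} (hq : q ≠ 0) {R : List ℕ} (hR : R.Nodup)
    {H : Finset ℕ → Finset ℕ → (ℕ → Bool) → A} (hH : IsPlanarFamily q R H) {ν : ℕ} (hν : ν ∉ R)
    (v : ℕ → A) :
    IsPlanarFamily q (R ++ [ν]) fun J J' ρ =>
      if ρ ν then q • ∑ j ∈ J, (-q) ^ (J.filter (j < ·)).card •
        moveRight q (fun J' => H (J.erase j) J' ρ) v j J'
      else rowExpand q (fun J' => H J J' ρ) v J' := by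
  intro Y D hYD
  have h : ∀ k ∈ Y ∪ D, (fun χ : ℕ ⊕ ℕ → Bool => rowCoeff q
      (fun J J' => H J J' fun i => χ (.inl i)) (χ (.inl ν))
      (colsOf Y D χ false) (colsOf Y D χ true) k * v k) ∈
      planarSpan q A ((R ++ [ν]).map Sum.inl ++ colList Y) := by
    intro k hk
    refine linearMap_comp_mem_planarSpan (LinearMap.mulRight K (v k)) ?_
    rcases Finset.mem_union.1 hk with hk | hk
    · exact rowCoeff_mem_planarSpan_of_mem hq hR hH hν hYD hk
    · exact rowCoeff_mem_planarSpan_of_mem_common hq hR hH hν hYD hk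
  convert Submodule.sum_mem _ h using 1
  ext χ
  rw [Finset.sum_apply]
  have hu : colsOf Y D χ false ∪ colsOf Y D χ true = Y ∪ D := by
    ext c
    simp only [Finset.mem_union, mem_colsOf]
    cases χ (.inr c) <;> grind
  rw [← hu]
  cases hχ : χ (.inl ν)
  · rw [sum_rowCoeff_false]
    simp [hχ]
  · rw [sum_rowCoeff_true]
    simp [hχ]

end RowExpansion

section Commutation

variable {K : Type*} [Field K] {A : Type*} [Ring A] [Algebra K A]

theorem card_filter_erase_add {J : Finset ℕ} {k : ℕ} (hk : k ∈ J) (p : ℕ → Prop)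
    [DecidablePred p] :
    ((J.erase k).filter p).card + (if p k then 1 else 0) = (J.filter p).card := by
  conv_rhs => rw [← Finset.insert_erase hk, Finset.filter_insert]
  split_ifs with h
  · rw [Finset.card_insert_of_notMem (by simp)]
  · rfl

theorem card_filter_insert_eq {J : Finset ℕ} {k : ℕ} (hk : k ∉ J) (p : ℕ → Prop)
    [DecidablePred p] :
    ((insert k J).filter p).card = (J.filter p).card + (if p k then 1 else 0) := by
  rw [Finset.filter_insert]
  split_ifs with h
  · rw [Finset.card_insert_of_notMem (by simp [hk])]
  · rfl

theorem card_filter_between {J : Finset ℕ} {k j : ℕ} (hkj : k < j) :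
    (J.filter (k < ·)).card = (J.filter fun t => k < t ∧ t < j).card + (if j ∈ J then 1 else 0) +
      (J.filter (j < ·)).card := by
  have : J.filter (k < ·) = ((J.filter fun t => k < t ∧ t < j) ∪ J.filter (· = j)) ∪
      J.filter (j < ·) := by
    ext t; simp only [Finset.mem_filter, Finset.mem_union]; grind
  rw [this, Finset.card_union_of_disjoint, Finset.card_union_of_disjoint]
  · congr 2
    rw [Finset.filter_eq']
    split_ifs <;> simp
  · exact Finset.disjoint_filter.2 fun _ _ h => by omega
  · rw [← Finset.filter_or]
    exact Finset.disjoint_filter.2 fun _ _ h => by omega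

theorem pow_card_filter_exchange {q : K} (hq : q ≠ 0) {J : Finset ℕ} {j k t : ℕ} (hj : j ∉ J)
    (hk : k ∈ J) (ht : t ∈ J) (hkj : k < j) (htk : t ≠ k) :
    (-q) ^ ((J.filter (t < ·)).card + ((J.erase t).filter fun r => k < r ∧ r < j).card) -
        (if k < t ∧ t < j then (q - q⁻¹) *
          (-q) ^ ((J.filter (k < ·)).card + ((J.erase k).filter fun r => t < r ∧ r < j).card)
        else 0) =
      (-q) ^ ((J.filter fun r => k < r ∧ r < j).card +
        ((insert j (J.erase k)).filter (t < ·)).card) := by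
  have h1 := card_filter_erase_add ht fun r => k < r ∧ r < j
  have h2 := card_filter_insert_eq (J := J.erase k) (k := j) (by simp [hj]) (t < ·)
  have h3 := card_filter_erase_add hk (t < ·)
  have h4 := card_filter_erase_add hk fun r => t < r ∧ r < j
  have h5 := card_filter_between (J := J) hkj
  have hjt : t ≠ j := ne_of_mem_of_not_mem ht hj
  rw [if_neg hj] at h5
  rcases lt_or_gt_of_ne htk with h | h
  · rw [if_neg (by omega), sub_zero]
    rw [if_neg (by omega)] at h1
    rw [if_pos (by omega)] at h2 h3
    congr 1
    omega
  · rw [if_neg (by omega)] at h3 h4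
    rcases lt_or_gt_of_ne hjt with h' | h'
    · have h6 := card_filter_between (J := J) h'
      rw [if_neg hj] at h6
      rw [if_pos ⟨h, h'⟩] at h1 ⊢
      rw [if_pos h'] at h2
      set E := (J.filter (t < ·)).card + ((J.erase t).filter fun r => k < r ∧ r < j).card
      rw [show (J.filter (k < ·)).card + ((J.erase k).filter fun r => t < r ∧ r < j).card = E + 1
        by omega, show (J.filter fun r => k < r ∧ r < j).card +
        ((insert j (J.erase k)).filter (t < ·)).card = E + 2 by omega]
      field_simp
      ring
    · rw [if_neg (by omega)] at h1 h2 ⊢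
      rw [sub_zero]
      congr 1
      omega

theorem sum_exchange {q : K} (hq : q ≠ 0) {J : Finset ℕ} {j : ℕ} (hj : j ∉ J) (W : ℕ → ℕ → A) :
    (∑ t ∈ J, ∑ k ∈ J.erase t, if k < j then (q - q⁻¹) • ((-q) ^ ((J.filter (t < ·)).card +
      ((J.erase t).filter fun r => k < r ∧ r < j).card) • (W t k -
        if t < k then (q - q⁻¹) • W k t else 0)) else 0) =
      (q - q⁻¹) • ∑ k ∈ J.filter (· < j), ∑ t ∈ J.erase k,
        (-q) ^ ((J.filter fun r => k < r ∧ r < j).card +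
          ((insert j (J.erase k)).filter (t < ·)).card) • W t k := by
  have erase_sum : ∀ (t : ℕ) (f : ℕ → A), ∑ k ∈ J.erase t, f k =
      ∑ k ∈ J, if k ≠ t then f k else 0 := by
    intro t f
    rw [← Finset.sum_filter, Finset.filter_ne']
  have split : ∀ t k, (if k ≠ t then (if k < j then (q - q⁻¹) • ((-q) ^
      ((J.filter (t < ·)).card + ((J.erase t).filter fun r => k < r ∧ r < j).card) • (W t k -
        if t < k then (q - q⁻¹) • W k t else 0)) else 0) else 0) =
      (if k ≠ t ∧ k < j then (q - q⁻¹) • ((-q) ^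
        ((J.filter (t < ·)).card + ((J.erase t).filter fun r => k < r ∧ r < j).card) • W t k)
        else 0) -
      if t < k ∧ k < j then (q - q⁻¹) • ((q - q⁻¹) * (-q) ^
        ((J.filter (t < ·)).card + ((J.erase t).filter fun r => k < r ∧ r < j).card)) • W k t
        else 0 := by
    intro t k
    by_cases h1 : k = t
    · simp [h1]
    · by_cases h2 : k < j <;> by_cases h3 : t < k <;> simp [h1, h2, h3]
      module
  simp only [erase_sum, split, Finset.sum_sub_distrib]
  rw [Finset.sum_comm (s := J) (t := J) (f := fun t k => if t < k ∧ k < j then _ else _),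
    ← Finset.sum_sub_distrib, Finset.sum_filter, Finset.smul_sum]
  rw [Finset.sum_congr rfl fun _ _ => (Finset.sum_sub_distrib _ _).symm, Finset.sum_comm]
  refine Finset.sum_congr rfl fun k hk => ?_
  by_cases hkj : k < j
  · rw [if_pos hkj, Finset.smul_sum]
    refine Finset.sum_congr rfl fun t ht => ?_
    by_cases htk : t = k
    · simp [htk]
    · rw [if_pos ⟨Ne.symm htk, hkj⟩, if_pos htk,
        ← pow_card_filter_exchange hq hj hk ht hkj htk]
      split_ifs <;> module
  · rw [if_neg hkj, smul_zero]
    refine Finset.sum_eq_zero fun t _ => ?_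
    rw [if_neg (by tauto), if_neg (by omega), sub_zero]

/-- Inductive step for moving a row `v` across a minor whose last row is `u`. -/
theorem smul_mul_rowExpand {q : K} (hq : q ≠ 0) {G : Finset ℕ → A} {u v : ℕ → A} {c : K}
    (hG : ∀ j J, v j * G J = moveRight q G v j J)
    (heq : ∀ t, c • (v t * u t) = q⁻¹ • (u t * v t))
    (hlt : ∀ k t, k < t → c • (v k * u t) = u t * v k)
    (hgt : ∀ k t, t < k → c • (v k * u t) = u t * v k - (q - q⁻¹) • (u k * v t))
    (j : ℕ) (J : Finset ℕ) :
    c • (v j * rowExpand q G u J) = moveRight q (rowExpand q G u) v j J := by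
  have hne : ∀ k t, k ≠ t → c • (v k * u t) =
      u t * v k - if t < k then (q - q⁻¹) • (u k * v t) else 0 := by
    intro k t hkt
    rcases lt_or_gt_of_ne hkt with h | h
    · rw [hlt k t h, if_neg h.not_gt, sub_zero]
    · rw [hgt k t h, if_pos h]
  have hassoc : ∀ X k t, c • (G X * v k * u t) = G X * (c • (v k * u t)) := by
    intro X k t
    rw [mul_smul_comm, mul_assoc]
  have expand : c • (v j * rowExpand q G u J) = ∑ t ∈ J, (-q) ^ (J.filter (t < ·)).card •
      (c • (moveRight q G v j (J.erase t) * u t)) := by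
    simp only [rowExpand, Finset.mul_sum, Finset.smul_sum]
    refine Finset.sum_congr rfl fun t _ => ?_
    rw [← hG, smul_comm, mul_smul_comm, mul_assoc, smul_comm]
  rw [expand]
  by_cases hj : j ∈ J
  · rw [← Finset.add_sum_erase J _ hj]
    have e1 : ∀ t ∈ J.erase j, (-q) ^ (J.filter (t < ·)).card •
        (c • (moveRight q G v j (J.erase t) * u t)) =
        q⁻¹ • (-q) ^ (J.filter (t < ·)).card • (G (J.erase t) * u t * v j) -
        if t < j then ((q - q⁻¹) * q⁻¹ * (-q) ^ (J.filter (t < ·)).card) •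
          (G (J.erase t) * u j * v t) else 0 := by
      intro t ht
      have hmem : j ∈ J.erase t := by grind
      rw [moveRight, if_pos hmem, smul_mul_assoc, smul_comm c, hassoc,
        hne j t (Finset.ne_of_mem_erase ht).symm, mul_sub, smul_sub, smul_sub, mul_ite]
      split_ifs
      · rw [mul_smul_comm, ← mul_assoc, ← mul_assoc]
        module
      · rw [← mul_assoc, mul_zero, smul_zero, smul_zero, sub_zero, sub_zero, smul_comm]
    rw [Finset.sum_congr rfl e1, Finset.sum_sub_distrib, ← Finset.sum_filter]
    have e2 : (J.erase j).filter (· < j) = J.filter (· < j) := by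
      ext; simp; omega
    have e3 : c • (moveRight q G v j (J.erase j) * u j) =
        q⁻¹ • (G (J.erase j) * u j * v j) - ∑ k ∈ J.filter (· < j),
          ((q - q⁻¹) * (-q) ^ (J.filter fun t => k < t ∧ t < j).card) •
            (G (J.erase k) * u j * v k) := by
      rw [moveRight, if_neg (by simp), sub_mul, smul_sub, hassoc, heq, e2, Finset.smul_sum,
        Finset.sum_mul, Finset.smul_sum]
      congr 1
      · rw [mul_smul_comm, mul_assoc]
      · refine Finset.sum_congr rfl fun k hk => ?_
        have hk := Finset.mem_filter.1 hk
        have hcard : ((J.erase j).filter fun t => k < t ∧ t < j).card =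
            (J.filter fun t => k < t ∧ t < j).card := by
          rw [← card_filter_erase_add hj, if_neg (by simp), add_zero]
        have hset : insert j ((J.erase j).erase k) = J.erase k := by
          ext; grind
        rw [hcard, hset, smul_mul_assoc, smul_mul_assoc, smul_comm c, smul_comm c, hassoc,
          hlt k j hk.2, ← mul_assoc, smul_smul]
    rw [e3, e2, moveRight, if_pos hj, rowExpand, Finset.sum_mul, Finset.smul_sum,
      ← Finset.add_sum_erase J _ hj, smul_sub, smul_comm _ q⁻¹, smul_mul_assoc]
    have e4 : (-q) ^ (J.filter (j < ·)).card • ∑ k ∈ J.filter (· < j),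
          ((q - q⁻¹) * (-q) ^ (J.filter fun t => k < t ∧ t < j).card) •
            (G (J.erase k) * u j * v k) = - ∑ t ∈ J.filter (· < j),
          ((q - q⁻¹) * q⁻¹ * (-q) ^ (J.filter (t < ·)).card) • (G (J.erase t) * u j * v t) := by
      rw [Finset.smul_sum, ← Finset.sum_neg_distrib]
      refine Finset.sum_congr rfl fun k hk => ?_
      have hk := Finset.mem_filter.1 hk
      rw [card_filter_between (J := J) hk.2, if_pos hj, smul_smul, ← neg_smul]
      congr 1
      simp only [pow_add, pow_one]
      field_simp
    rw [e4]
    simp only [smul_mul_assoc]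
    abel
  · set W : ℕ → ℕ → A := fun t k => G (insert j ((J.erase t).erase k)) * u t * v k with hW
    have e1 : ∀ t ∈ J, (-q) ^ (J.filter (t < ·)).card •
        (c • (moveRight q G v j (J.erase t) * u t)) =
        (-q) ^ (J.filter (t < ·)).card • (G (J.erase t) * u t * v j) -
        (if t < j then ((q - q⁻¹) * (-q) ^ (J.filter (t < ·)).card) •
          (G (J.erase t) * u j * v t) else 0) -
        ∑ k ∈ J.erase t, if k < j then (q - q⁻¹) • ((-q) ^ ((J.filter (t < ·)).card +
          ((J.erase t).filter fun r => k < r ∧ r < j).card) • (W t k -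
            if t < k then (q - q⁻¹) • W k t else 0)) else 0 := by
      intro t ht
      rw [moveRight, if_neg (by simp [hj]), sub_mul, smul_sub, hassoc,
        hne j t (ne_of_mem_of_not_mem ht hj).symm, mul_sub, smul_sub, smul_sub, ← mul_assoc]
      congr 1
      · congr 1
        rw [mul_ite]
        split_ifs
        · rw [mul_smul_comm, ← mul_assoc]
          module
        · simp
      · rw [← Finset.sum_filter, smul_mul_assoc, Finset.sum_mul, smul_comm c, Finset.smul_sum,
          Finset.smul_sum, Finset.smul_sum]
        refine Finset.sum_congr rfl fun k hk => ?_
        have hk := Finset.mem_erase.1 (Finset.mem_filter.1 hk).1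
        rw [smul_mul_assoc, smul_comm c, hassoc, hne k t hk.1, mul_sub, ← mul_assoc, mul_ite,
          mul_smul_comm, ← mul_assoc, mul_zero, pow_add, mul_smul]
        simp only [hW, Finset.erase_right_comm (a := k) (b := t)]
        module
    have e2 : ∀ k ∈ J.filter (· < j), (-q) ^ (J.filter fun t => k < t ∧ t < j).card •
        (rowExpand q G u (insert j (J.erase k)) * v k) =
        (-q) ^ (J.filter (k < ·)).card • (G (J.erase k) * u j * v k) +
        ∑ t ∈ J.erase k, (-q) ^ ((J.filter fun r => k < r ∧ r < j).card +
          ((insert j (J.erase k)).filter (t < ·)).card) • W t k := by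
      intro k hk
      obtain ⟨hk, hkj⟩ := Finset.mem_filter.1 hk
      rw [rowExpand, Finset.sum_insert (by simp [hj]), Finset.erase_insert (by simp [hj]), add_mul,
        smul_add, Finset.sum_mul, Finset.smul_sum]
      congr 1
      · rw [smul_mul_assoc, smul_smul, ← pow_add, card_filter_between (J := J) hkj, if_neg hj]
        congr 3
        rw [card_filter_insert_eq (by simp [hj]), if_neg (lt_irrefl _),
          ← card_filter_erase_add hk, if_neg (by omega)]
      · refine Finset.sum_congr rfl fun t ht => ?_
        have ht := Finset.mem_erase.1 ht
        rw [smul_mul_assoc, smul_smul, ← pow_add]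
        simp only [hW]
        rw [Finset.erase_right_comm (s := J),
          Finset.erase_insert_of_ne (ne_of_mem_of_not_mem ht.2 hj).symm]
    rw [Finset.sum_congr rfl e1, Finset.sum_sub_distrib, Finset.sum_sub_distrib, moveRight,
      if_neg hj, Finset.sum_congr rfl e2, Finset.sum_add_distrib, rowExpand, Finset.sum_mul,
      smul_add, ← sub_sub, ← Finset.sum_filter, Finset.smul_sum (s := J.filter (· < j))]
    simp only [smul_mul_assoc, smul_smul]
    congr 1
    simpa only [smul_smul] using sum_exchange hq hj W

end Commutation

section Minors

variable {K : Type*} [Field K] {A : Type*} [Ring A] [Algebra K A]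

/-- Manin's relations for an array without bounds on the indices. -/
structure IsQArray (q : K) (x : ℕ → ℕ → A) : Prop where
  row : ∀ i {j k}, j < k → x i j * x i k = q • (x i k * x i j)
  col : ∀ {i l} j, i < l → x i j * x l j = q • (x l j * x i j)
  comm : ∀ {i l j k}, i < l → j < k → x i k * x l j = x l j * x i k
  cross : ∀ {i l j k}, i < l → j < k → x i j * x l k - x l k * x i j = (q - q⁻¹) • (x i k * x l j)

/-- The quantum minor with rows `l`, listed from the last one to the first one. -/
def listMinor (q : K) (x : ℕ → ℕ → A) : List ℕ → Finset ℕ → A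
  | [], J => if J = ∅ then 1 else 0
  | a :: l, J => rowExpand q (listMinor q x l) (x a) J

theorem listMinor_cons (q : K) (x : ℕ → ℕ → A) (a : ℕ) (l : List ℕ) (J : Finset ℕ) :
    listMinor q x (a :: l) J = rowExpand q (listMinor q x l) (x a) J :=
  rfl

theorem mul_listMinor {q : K} (hq : q ≠ 0) {x : ℕ → ℕ → A} (hx : IsQArray q x) {b : ℕ}
    (l : List ℕ) (hl : ∀ a ∈ l, a < b) (j : ℕ) (J : Finset ℕ) :
    x b j * listMinor q x l J = moveRight q (listMinor q x l) (x b) j J := by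
  induction l generalizing j J with
  | nil =>
    by_cases hj : j ∈ J
    · have : J ≠ ∅ := Finset.ne_empty_of_mem hj
      simp [moveRight, listMinor, hj, this]
    · by_cases hJ : J = ∅ <;> simp [moveRight, listMinor, hJ, hj]
  | cons a l ih =>
    have hab : a < b := hl a (by simp)
    have := smul_mul_rowExpand (c := 1) hq (G := listMinor q x l) (u := x a) (v := x b)
      (fun j J => ih (fun a ha => hl a (by simp [ha])) j J)
      (fun t => by rw [hx.col t hab, smul_smul, inv_mul_cancel₀ hq])
      (fun k t h => by rw [one_smul, hx.comm hab h])
      (fun k t h => by rw [one_smul, ← hx.cross hab h, sub_sub_cancel]) j J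
    rwa [one_smul] at this

theorem smul_mul_listMinor_cons {q : K} (hq : q ≠ 0) {x : ℕ → ℕ → A} (hx : IsQArray q x) {b : ℕ}
    (l : List ℕ) (hl : ∀ a ∈ l, a < b) (j : ℕ) (J : Finset ℕ) :
    q⁻¹ • (x b j * listMinor q x (b :: l) J) =
      moveRight q (listMinor q x (b :: l)) (x b) j J := by
  refine smul_mul_rowExpand hq (mul_listMinor hq hx l hl) (fun t => rfl) (fun k t h => ?_)
    (fun k t h => ?_) j J
  · rw [hx.row b h, smul_smul, inv_mul_cancel₀ hq, one_smul]
  · rw [hx.row b h]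
    module

theorem rowExpand_rowExpand_self {q : K} (G : Finset ℕ → A) {v : ℕ → A}
    (hv : ∀ {j k}, j < k → v j * v k = q • (v k * v j)) (J : Finset ℕ) :
    rowExpand q (rowExpand q G v) v J = 0 := by
  have h1 : rowExpand q (rowExpand q G v) v J = ∑ k ∈ J, ∑ t ∈ J, if t ≠ k then
      (-q) ^ ((J.filter (k < ·)).card + ((J.erase k).filter (t < ·)).card) •
        (G ((J.erase k).erase t) * v t * v k) else 0 := by
    refine Finset.sum_congr rfl fun k _ => ?_
    rw [← Finset.sum_filter, Finset.filter_ne', rowExpand, Finset.sum_mul, Finset.smul_sum]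
    refine Finset.sum_congr rfl fun t _ => ?_
    rw [smul_mul_assoc, smul_smul, pow_add]
  have h2 : ∀ k ∈ J, ∀ t ∈ J, (if t ≠ k then
      (-q) ^ ((J.filter (k < ·)).card + ((J.erase k).filter (t < ·)).card) •
        (G ((J.erase k).erase t) * v t * v k) else 0) =
      (if k < t then (-q) ^ ((J.filter (k < ·)).card + (J.filter (t < ·)).card) •
        (G ((J.erase k).erase t) * v t * v k) else 0) -
      if t < k then (-q) ^ ((J.filter (t < ·)).card + (J.filter (k < ·)).card) •
        (G ((J.erase t).erase k) * v k * v t) else 0 := by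
    intro k hk t ht
    have hc := card_filter_erase_add hk (t < ·)
    rcases lt_trichotomy k t with h | rfl | h
    · rw [if_neg h.not_gt] at hc
      rw [if_pos h.ne', if_pos h, if_neg h.not_gt, sub_zero, ← hc, add_zero]
    · simp
    · rw [if_pos h] at hc
      rw [if_pos h.ne, if_neg h.not_gt, if_pos h, mul_assoc, hv h, ← hc, zero_sub,
        Finset.erase_right_comm (a := t), mul_smul_comm, smul_smul, ← mul_assoc, ← neg_smul]
      congr 1
      ring
  rw [h1, Finset.sum_congr rfl fun k hk => Finset.sum_congr rfl (h2 k hk)]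
  simp only [Finset.sum_sub_distrib]
  rw [sub_eq_zero, Finset.sum_comm]

theorem listMinor_cons_cons_self {q : K} {x : ℕ → ℕ → A} (hx : IsQArray q x)
    (b : ℕ) (l : List ℕ) (J : Finset ℕ) : listMinor q x (b :: b :: l) J = 0 :=
  rowExpand_rowExpand_self _ (hx.row b) J

/-- The permutation of `Fin (n + 1)` sending the last element to `p` and acting as `τ` on the
other ones. -/
def permInsertLast {n : ℕ} (p : Fin (n + 1)) (τ : Equiv.Perm (Fin n)) : Equiv.Perm (Fin (n + 1)) :=
  (finSuccEquiv' (Fin.last n)).trans ((Equiv.optionCongr τ).trans (finSuccEquiv' p).symm)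

@[simp]
theorem permInsertLast_last {n : ℕ} (p : Fin (n + 1)) (τ : Equiv.Perm (Fin n)) :
    permInsertLast p τ (Fin.last n) = p := by
  simp [permInsertLast]

@[simp]
theorem permInsertLast_castSucc {n : ℕ} (p : Fin (n + 1)) (τ : Equiv.Perm (Fin n)) (d : Fin n) :
    permInsertLast p τ d.castSucc = p.succAbove (τ d) := by
  rw [← Fin.succAbove_last_apply]
  simp [permInsertLast, -Fin.succAbove_last]

theorem permInsertLast_bijective (n : ℕ) :
    Function.Bijective fun pτ : Fin (n + 1) × Equiv.Perm (Fin n) => permInsertLast pτ.1 pτ.2 := by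
  rw [Fintype.bijective_iff_injective_and_card]
  constructor
  · rintro ⟨p, τ⟩ ⟨p', τ'⟩ h
    have hp : p = p' := by
      simpa using congrArg (fun σ : Equiv.Perm (Fin (n + 1)) => σ (Fin.last n)) h
    subst hp
    refine Prod.ext rfl (Equiv.ext fun d => ?_)
    simpa using congrArg (fun σ : Equiv.Perm (Fin (n + 1)) => σ d.castSucc) h
  · simp [Fintype.card_perm, Nat.factorial_succ]

theorem permInversions_eq_sum {k : ℕ} (σ : Equiv.Perm (Fin k)) :
    permInversions σ = ∑ j, ∑ i, if i < j ∧ σ j < σ i then 1 else 0 := by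
  rw [permInversions, Finset.card_filter, Fintype.sum_prod_type, Finset.sum_comm]

theorem permInversions_permInsertLast {n : ℕ} (p : Fin (n + 1)) (τ : Equiv.Perm (Fin n)) :
    permInversions (permInsertLast p τ) =
      permInversions τ + (Finset.univ.filter (p < ·)).card := by
  have h : (Finset.univ.filter (p < ·)).card = ∑ i, if p < permInsertLast p τ i then 1 else 0 := by
    rw [Finset.card_filter, Equiv.sum_comp (permInsertLast p τ) fun i => if p < i then 1 else 0]
  rw [h, permInversions_eq_sum, permInversions_eq_sum, Fin.sum_univ_castSucc]
  congr 1
  · refine Finset.sum_congr rfl fun j _ => ?_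
    rw [Fin.sum_univ_castSucc]
    simp [Fin.succAbove_lt_succAbove_iff, (Fin.castSucc_lt_last j).not_gt]
  · refine Finset.sum_congr rfl fun i _ => ?_
    rcases Fin.eq_castSucc_or_eq_last i with ⟨i, rfl⟩ | rfl
    · simp [Fin.castSucc_lt_last]
    · simp

theorem sum_perm_eq_listMinor (q : K) (x : ℕ → ℕ → A) {n : ℕ} (a : Fin n → ℕ) (J : Finset ℕ)
    (hJ : J.card = n) :
    ∑ σ : Equiv.Perm (Fin n), (-q) ^ permInversions σ •
      (List.ofFn fun d => x (a d) (J.orderEmbOfFin hJ (σ d))).prod =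
    listMinor q x (List.ofFn a).reverse J := by
  induction n generalizing J with
  | zero =>
    have : J = ∅ := Finset.card_eq_zero.1 hJ
    simp [listMinor, this, permInversions]
  | succ n ih =>
    have hl : (List.ofFn a).reverse =
        a (Fin.last n) :: (List.ofFn fun d : Fin n => a d.castSucc).reverse := by
      rw [List.ofFn_succ', List.concat_eq_append, List.reverse_concat]
    have he : ∀ p : Fin (n + 1), (J.erase (J.orderEmbOfFin hJ p)).card = n := fun p => by
      rw [Finset.card_erase_of_mem (Finset.orderEmbOfFin_mem _ _ _), hJ, Nat.add_sub_cancel]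
    have hs : ∀ p d, J.orderEmbOfFin hJ (p.succAbove d) =
        (J.erase (J.orderEmbOfFin hJ p)).orderEmbOfFin (he p) d := by
      intro p d
      refine congrFun (Finset.orderEmbOfFin_unique (he p)
        (f := fun d => J.orderEmbOfFin hJ (p.succAbove d)) (fun d => ?_) ?_) d
      · simp [Fin.succAbove_ne]
      · exact (J.orderEmbOfFin hJ).strictMono.comp (Fin.strictMono_succAbove p)
    have hc : ∀ p, (J.filter (J.orderEmbOfFin hJ p < ·)).card =
        (Finset.univ.filter (p < ·)).card := by
      intro p
      rw [← Finset.card_map (J.orderEmbOfFin hJ).toEmbedding]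
      congr 1
      ext c
      simp only [Finset.mem_filter, Finset.mem_map, Finset.mem_univ, true_and]
      constructor
      · rintro ⟨hc, h⟩
        obtain ⟨d, rfl⟩ : c ∈ Set.range (J.orderEmbOfFin hJ) := by simpa using hc
        exact ⟨d, by simpa using h, rfl⟩
      · rintro ⟨d, h, rfl⟩
        simpa using h
    have hr : ∀ f : ℕ → A, ∑ k ∈ J, f k = ∑ p, f (J.orderEmbOfFin hJ p) := by
      intro f
      conv_lhs => rw [← Finset.map_orderEmbOfFin_univ J hJ, Finset.sum_map]
      rfl
    rw [hl, listMinor, rowExpand, hr, ← (permInsertLast_bijective n).sum_comp,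
      Fintype.sum_prod_type]
    refine Finset.sum_congr rfl fun p _ => ?_
    rw [← ih (fun d => a d.castSucc) _ (he p), Finset.sum_mul, Finset.smul_sum]
    refine Finset.sum_congr rfl fun τ _ => ?_
    rw [List.ofFn_succ', List.concat_eq_append, List.prod_append, List.prod_singleton,
      permInversions_permInsertLast, hc, smul_mul_assoc, smul_smul, pow_add, mul_comm]
    simp [hs]

end Minors

theorem qMinor_eq_listMinor {K : Type} [Field K] {A : Type} [Ring A] [Algebra K A]
    (q : K) (x : ℕ → ℕ → A) {I J : Finset ℕ} (h : I.card = J.card) :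
    qMinor q x I J = listMinor q x (I.sort (· ≥ ·)) J := by
  have hs : I.sort (· ≥ ·) = (List.ofFn (I.orderEmbOfFin rfl)).reverse := by
    refine List.Perm.eq_of_pairwise' (r := (· ≥ ·)) ?_ ?_ ?_
    · exact Finset.pairwise_sort I (· ≥ ·)
    · rw [List.pairwise_reverse]
      exact (List.pairwise_ofFn.2 fun i j h => ((I.orderEmbOfFin rfl).strictMono h).le)
    · refine (List.perm_ext_iff_of_nodup (Finset.sort_nodup _ _) ?_).2 ?_
      · rw [List.nodup_reverse]
        exact List.nodup_ofFn.2 (I.orderEmbOfFin rfl).injective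
      · intro c
        rw [Finset.mem_sort, List.mem_reverse, List.mem_ofFn, ← Set.mem_range,
          Finset.range_orderEmbOfFin, Finset.mem_coe]
  rw [qMinor, dif_pos h, hs, ← sum_perm_eq_listMinor q x _ J h.symm]

section RowInduction

variable {K : Type*} [Field K] {A : Type*} [Ring A] [Algebra K A]

theorem rowExpand_smul_mul (q c : K) (a : A) (G : Finset ℕ → A) (v : ℕ → A) (J : Finset ℕ) :
    rowExpand q (fun J => c • (a * G J)) v J = c • (a * rowExpand q G v J) := by
  simp only [rowExpand, Finset.mul_sum, Finset.smul_sum]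
  refine Finset.sum_congr rfl fun k _ => ?_
  rw [smul_mul_assoc, mul_assoc, mul_smul_comm, smul_comm]

theorem moveRight_smul_mul (q c : K) (a : A) (G : Finset ℕ → A) (v : ℕ → A) (j : ℕ)
    (J : Finset ℕ) :
    moveRight q (fun J => c • (a * G J)) v j J = c • (a * moveRight q G v j J) := by
  unfold moveRight
  split_ifs
  · rw [smul_mul_assoc, mul_assoc, mul_smul_comm, smul_comm]
  · rw [mul_sub, smul_sub, smul_mul_assoc, mul_assoc, mul_smul_comm, smul_comm c, Finset.mul_sum,
      Finset.smul_sum (r := c)]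
    congr 2
    refine Finset.sum_congr rfl fun k _ => ?_
    rw [smul_mul_assoc, mul_assoc, mul_smul_comm, smul_comm c]

theorem sum_moveRight_eq_smul_rowExpand_mul {q c d : K} {E G : Finset ℕ → A} {v : ℕ → A}
    (h : ∀ j J, d • (v j * G J) = moveRight q G v j J) (J J' : Finset ℕ) :
    q • ∑ j ∈ J, (-q) ^ (J.filter (j < ·)).card •
      moveRight q (fun J' => c • (E (J.erase j) * G J')) v j J' =
    (q * d * c) • (rowExpand q E v J * G J') := by
  rw [rowExpand, Finset.sum_mul, mul_assoc, mul_smul, Finset.smul_sum (r := d * c)]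
  congr 1
  refine Finset.sum_congr rfl fun j _ => ?_
  rw [moveRight_smul_mul, ← h, mul_smul_comm, smul_mul_assoc, mul_assoc]
  module

/-- The product of the quantum minors with rows in `l` that are common or have color `true`,
resp. `false`, normalized by a power of `q`. -/
def coloredMinors (q : K) (x : ℕ → ℕ → A) (C : Finset ℕ) (l : List ℕ) (J J' : Finset ℕ)
    (ρ : ℕ → Bool) : A :=
  q ^ (l.filter fun i => i ∉ C ∧ ρ i = true).length •
    (listMinor q x (l.filter fun i => i ∈ C ∨ ρ i = true) J *
      listMinor q x (l.filter fun i => i ∈ C ∨ ρ i = false) J')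

theorem coloredMinors_congr (q : K) (x : ℕ → ℕ → A) (C : Finset ℕ) {l : List ℕ} (J J' : Finset ℕ)
    {ρ ρ' : ℕ → Bool} (h : ∀ i ∈ l, i ∉ C → ρ i = ρ' i) :
    coloredMinors q x C l J J' ρ = coloredMinors q x C l J J' ρ' := by
  have h' : ∀ b, (l.filter fun i => i ∈ C ∨ ρ i = b) = l.filter fun i => i ∈ C ∨ ρ' i = b :=
    fun b => List.filter_congr fun i hi => by
      by_cases hC : i ∈ C
      · simp [hC]
      · rw [h i hi hC]
  have h'' : (l.filter fun i => i ∉ C ∧ ρ i = true) = l.filter fun i => i ∉ C ∧ ρ' i = true :=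
    List.filter_congr fun i hi => by
      by_cases hC : i ∈ C
      · simp [hC]
      · rw [h i hi hC]
  simp only [coloredMinors, h', h'']

theorem isPlanarFamily_coloredMinors_nil (q : K) (x : ℕ → ℕ → A) (C : Finset ℕ) :
    IsPlanarFamily q [] (coloredMinors q x C []) := by
  intro Y D hYD
  rcases Y.eq_empty_or_nonempty with rfl | ⟨j, hj⟩
  · have := matchWeight_smul_mem_planarSpan (q := q) (α := ℕ ⊕ ℕ) PlanarMatching.nil
      (((if D = ∅ then 1 else 0) * if D = ∅ then 1 else 0 : A))
    simpa [coloredMinors, listMinor, colsOf, matchWeight] using this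
  · convert Submodule.zero_mem _ using 1
    ext χ
    cases hχ : χ (.inr j)
    · have : colsOf Y D χ false ≠ ∅ :=
        Finset.ne_empty_of_mem (mem_colsOf.2 (.inl ⟨hj, hχ⟩))
      simp [coloredMinors, listMinor, this]
    · have : colsOf Y D χ true ≠ ∅ :=
        Finset.ne_empty_of_mem (mem_colsOf.2 (.inl ⟨hj, hχ⟩))
      simp [coloredMinors, listMinor, this]

theorem isPlanarFamily_coloredMinors {q : K} (hq : q ≠ 0) {x : ℕ → ℕ → A} (hx : IsQArray q x)
    (C : Finset ℕ) (l : List ℕ) (hl : l.Pairwise (· > ·)) :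
    IsPlanarFamily q (l.filter (· ∉ C)).reverse (coloredMinors q x C l) := by
  induction l with
  | nil => exact isPlanarFamily_coloredMinors_nil q x C
  | cons N l ih =>
    obtain ⟨hN, hl⟩ := List.pairwise_cons.1 hl
    specialize ih hl
    have hnd : (l.filter (· ∉ C)).reverse.Nodup :=
      List.nodup_reverse.2 ((hl.imp fun h => ne_of_gt h).filter _)
    have hlt : ∀ (p : ℕ → Bool), ∀ i ∈ l.filter p, i < N := fun p i hi =>
      hN i (List.mem_of_mem_filter hi)
    have hNl : ∀ i ∈ l, i ≠ N ∧ i ≠ N + 1 := fun i hi => by have := hN i hi; omega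
    have hNR : N ∉ (l.filter (· ∉ C)).reverse := fun h =>
      (hlt _ _ (List.mem_reverse.1 h)).false
    have step := ih.step hq hnd hNR (x N)
    have move : ∀ ρ : ℕ → Bool, ∀ j J, (1 : K) • (x N j * listMinor q x
        (l.filter fun i => i ∈ C ∨ ρ i = false) J) = moveRight q _ (x N) j J := fun ρ j J => by
      rw [one_smul, mul_listMinor hq hx _ (hlt _)]
    have move' : ∀ ρ : ℕ → Bool, ∀ j J, q⁻¹ • (x N j * listMinor q x
        (N :: l.filter fun i => i ∈ C ∨ ρ i = false) J) = moveRight q _ (x N) j J := fun ρ j J => by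
      rw [smul_mul_listMinor_cons hq hx _ (hlt _)]
    by_cases hNC : N ∈ C
    · have hNR' : N + 1 ∉ (l.filter (· ∉ C)).reverse ++ [N] := by
        simp
        intro h
        have := hN _ h
        omega
      have step2 := step.step hq (List.nodup_append.2 ⟨hnd, by simp, by
        rintro i hi j hj rfl
        rw [List.mem_singleton.1 hj] at hi
        exact hNR hi⟩) hNR' (x N)
      set H := fun (J J' : Finset ℕ) (ρ : ℕ → Bool) =>
        if ρ N then q • ∑ j ∈ J, (-q) ^ (J.filter (j < ·)).card •
        moveRight q (fun J' => coloredMinors q x C l (J.erase j) J' ρ) (x N) j J'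
        else rowExpand q (fun J' => coloredMinors q x C l J J' ρ) (x N) J' with hH
      set H₂ := fun (J J' : Finset ℕ) (ρ : ℕ → Bool) =>
        if ρ (N + 1) then q • ∑ j ∈ J, (-q) ^ (J.filter (j < ·)).card •
        moveRight q (fun J' => H (J.erase j) J' ρ) (x N) j J'
        else rowExpand q (fun J' => H J J' ρ) (x N) J' with hH₂
      have hHt : ∀ J J' ρ, ρ N = true → H J J' ρ =
          (q * 1 * q ^ (l.filter fun i => i ∉ C ∧ ρ i = true).length) •
            (listMinor q x (N :: l.filter fun i => i ∈ C ∨ ρ i = true) J *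
              listMinor q x (l.filter fun i => i ∈ C ∨ ρ i = false) J') := by
        intro J J' ρ h
        simp only [hH, h, if_true]
        exact sum_moveRight_eq_smul_rowExpand_mul (move ρ) J J'
      have hHf : ∀ J J' ρ, ρ N = false → H J J' ρ =
          (q ^ (l.filter fun i => i ∉ C ∧ ρ i = true).length) •
            (listMinor q x (l.filter fun i => i ∈ C ∨ ρ i = true) J *
              listMinor q x (N :: l.filter fun i => i ∈ C ∨ ρ i = false) J') := by
        intro J J' ρ h
        simp only [hH, h, Bool.false_eq_true, if_false]
        exact rowExpand_smul_mul _ _ _ _ _ _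
      have h_tt : ∀ J J' ρ, ρ N = true → ρ (N + 1) = true → H₂ J J' ρ = 0 := by
        intro J J' ρ h h'
        simp only [hH₂, h', if_true, hHt _ _ _ h]
        rw [sum_moveRight_eq_smul_rowExpand_mul (E := listMinor q x _) (move ρ) J J',
          ← listMinor_cons, listMinor_cons_cons_self hx, zero_mul, smul_zero]
      have h_ff : ∀ J J' ρ, ρ N = false → ρ (N + 1) = false → H₂ J J' ρ = 0 := by
        intro J J' ρ h h'
        simp only [hH₂, h', Bool.false_eq_true, if_false, hHf _ _ _ h]
        rw [rowExpand_smul_mul, ← listMinor_cons, listMinor_cons_cons_self hx, mul_zero, smul_zero]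
      have h_tf : ∀ J J' ρ, ρ N = true → ρ (N + 1) = false →
          H₂ J J' ρ = q • coloredMinors q x C (N :: l) J J' ρ := by
        intro J J' ρ h h'
        simp only [hH₂, h', Bool.false_eq_true, if_false, hHt _ _ _ h]
        rw [rowExpand_smul_mul, coloredMinors, smul_smul, mul_one]
        simp [hNC, listMinor_cons]
      have h_ft : ∀ J J' ρ, ρ N = false → ρ (N + 1) = true →
          H₂ J J' ρ = coloredMinors q x C (N :: l) J J' ρ := by
        intro J J' ρ h h'
        simp only [hH₂, h', if_true, hHf _ _ _ h]
        rw [sum_moveRight_eq_smul_rowExpand_mul (E := listMinor q x _) (move' ρ) J J',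
          mul_inv_cancel₀ hq, one_mul, coloredMinors]
        simp [hNC, listMinor_cons]
      have inv : ∀ (χ : ℕ ⊕ ℕ → Bool) (a b : ℕ) (c d : Bool) (Y D : Finset ℕ) (e : Bool),
          colsOf Y D (recolor χ (.inl a) c (.inl b) d) e = colsOf Y D χ e := by
        intro χ a b c d Y D e
        unfold colsOf
        congr 2
      have hne : (Sum.inl N : ℕ ⊕ ℕ) ≠ .inl (N + 1) := by simp
      have h_ft' : ∀ (χ : ℕ ⊕ ℕ → Bool) (J J' : Finset ℕ), H₂ J J' (fun i =>
          recolor χ (.inl N) false (.inl (N + 1)) true (.inl i)) =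
            coloredMinors q x C (N :: l) J J' fun i => χ (.inl i) := by
        intro χ J J'
        rw [h_ft _ _ (fun i => recolor χ (.inl N) false (.inl (N + 1)) true (.inl i))
          (recolor_fst hne) recolor_snd]
        exact coloredMinors_congr _ _ _ _ _ fun i hi hiC => recolor_of_ne (by grind) (by grind)
      have h_tf' : ∀ (χ : ℕ ⊕ ℕ → Bool) (J J' : Finset ℕ), H₂ J J' (fun i =>
          recolor χ (.inl N) true (.inl (N + 1)) false (.inl i)) =
            q • coloredMinors q x C (N :: l) J J' fun i => χ (.inl i) := by
        intro χ J J'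
        rw [h_tf _ _ (fun i => recolor χ (.inl N) true (.inl (N + 1)) false (.inl i))
          (recolor_fst hne) recolor_snd]
        congr 1
        exact coloredMinors_congr _ _ _ _ _ fun i hi hiC => recolor_of_ne (by grind) (by grind)
      intro Y D hYD
      have h2 := step2 Y D hYD
      have e : ((l.filter (· ∉ C)).reverse ++ [N] ++ [N + 1]).map (Sum.inl : ℕ → ℕ ⊕ ℕ) ++
          colList Y = (l.filter (· ∉ C)).reverse.map Sum.inl ++
            .inl N :: .inl (N + 1) :: colList Y := by simp
      rw [e] at h2
      have hR : ((N :: l).filter (· ∉ C)).reverse = (l.filter (· ∉ C)).reverse := by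
        simp [hNC]
      rw [hR]
      convert removal_mem_planarSpan hq ?_ h2 ?_ ?_ using 1
      · ext χ
        rw [inv, inv, h_ft']
      · rw [← e]
        have hnd' := nodup_rows_append_columns (R := (l.filter (· ∉ C)).reverse ++ [N] ++ [N + 1])
          (C := Y.sort (· ≥ ·)) ?_ (Y.sort_nodup _)
        · exact hnd'
        · rw [← List.concat_eq_append, List.nodup_concat]
          refine ⟨hNR', ?_⟩
          rw [← List.concat_eq_append, List.nodup_concat]
          exact ⟨hNR, hnd⟩
      · intro χ h
        cases h' : χ (.inl N)
        · exact h_ff _ _ (fun i => χ (.inl i)) h' (h ▸ h' : χ (.inl (N + 1)) = false)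
        · exact h_tt _ _ (fun i => χ (.inl i)) h' (h ▸ h' : χ (.inl (N + 1)) = true)
      · intro χ
        rw [inv, inv, inv, inv, h_ft', h_tf']
    · have hR : ((N :: l).filter (· ∉ C)).reverse = (l.filter (· ∉ C)).reverse ++ [N] := by
        simp [hNC]
      rw [hR]
      convert step using 1
      ext J J' ρ
      cases h : ρ N
      · simp only [Bool.false_eq_true, if_false]
        simp only [coloredMinors]
        rw [rowExpand_smul_mul]
        simp [hNC, h]
        rfl
      · simp only [if_true]
        simp only [coloredMinors]
        rw [sum_moveRight_eq_smul_rowExpand_mul (E := listMinor q x _) (move ρ) J J', mul_one]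
        simp [hNC, h, pow_succ']
        rfl

end RowInduction

section Configurations

namespace Cortege

variable {m n : ℕ} (S : Cortege m n)

/-- The coloring attached to a cortege: `true` for white rows and black columns. -/
def coloring : Elt → Bool := Sum.elim (fun i => decide (i ∈ S.I)) fun j => decide (j ∈ S.J')

variable {S}

theorem inl_mem_ground {i : ℕ} :
    (Sum.inl i : Elt) ∈ S.ground ↔ i ∈ S.I ∪ S.I' ∧ i ∉ S.I ∩ S.I' := by
  simp [ground, whites, blacks]; tauto

theorem inr_mem_ground {j : ℕ} :
    (Sum.inr j : Elt) ∈ S.ground ↔ j ∈ S.J ∪ S.J' ∧ j ∉ S.J ∩ S.J' := by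
  simp [ground, whites, blacks]; tauto

theorem mem_whites_iff {a : Elt} (ha : a ∈ S.ground) :
    a ∈ S.whites ↔ S.coloring a = a.isLeft := by
  rcases a with i | j
  · have := inl_mem_ground.1 ha
    simp [whites, coloring] at this ⊢
    tauto
  · have := inr_mem_ground.1 ha
    simp [whites, coloring] at this ⊢
    tauto

theorem mem_blacks_iff {a : Elt} (ha : a ∈ S.ground) :
    a ∈ S.blacks ↔ S.coloring a ≠ a.isLeft := by
  rcases a with i | j
  · have := inl_mem_ground.1 ha
    simp [blacks, coloring] at this ⊢
    tauto
  · have := inr_mem_ground.1 ha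
    simp [blacks, coloring] at this ⊢
    tauto

end Cortege

variable {m n : ℕ}

theorem numMin_eq_or (p : Elt × Elt) : numMin p = p.1 ∨ numMin p = p.2 := by
  unfold numMin
  split_ifs <;> simp

theorem feasible_couple_iff {S : Cortege m n} {p : Elt × Elt} (h₁ : p.1 ∈ S.ground)
    (h₂ : p.2 ∈ S.ground) :
    ((sameSide p.1 p.2 → (p.1 ∈ S.whites ↔ p.2 ∈ S.blacks)) ∧
      (¬ sameSide p.1 p.2 → (p.1 ∈ S.whites ↔ p.2 ∈ S.whites))) ↔
    S.coloring p.1 ≠ S.coloring p.2 := by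
  rw [Cortege.mem_whites_iff h₁, Cortege.mem_whites_iff h₂, Cortege.mem_blacks_iff h₂, sameSide]
  cases S.coloring p.1 <;> cases S.coloring p.2 <;> cases p.1.isLeft <;> cases p.2.isLeft <;> simp

theorem cLT_asymm : ∀ a b : Elt, cLT a b → ¬ cLT b a := by
  rintro (a | a) (b | b) h h' <;> simp only [cLT] at h h' <;> omega

theorem isFeasible_toFinset_iff {S : Cortege m n} {L : List Elt} {M : Multiset (Elt × Elt)}
    (hM : PlanarMatching L M) (hL : L.Pairwise cLT) (hnd : L.Nodup)
    (hS : ∀ a, a ∈ L ↔ a ∈ S.ground) :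
    IsFeasible S M.toFinset ↔ ∀ p ∈ M, S.coloring p.1 ≠ S.coloring p.2 := by
  have hmem : ∀ p ∈ M, p.1 ∈ S.ground ∧ p.2 ∈ S.ground := fun p hp =>
    ⟨(hS _).1 (hM.mem_of_mem p hp).1, (hS _).1 (hM.mem_of_mem p hp).2⟩
  obtain ⟨hlt, hnc⟩ := hM.noncrossing cLT_asymm hL
  simp only [IsFeasible, Multiset.mem_toFinset]
  constructor
  · rintro ⟨-, -, h, -⟩ p hp
    exact (feasible_couple_iff (hmem p hp).1 (hmem p hp).2).1 (h p hp)
  · intro h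
    refine ⟨fun p hp => ⟨(hmem p hp).1, (hmem p hp).2, hlt p hp⟩, fun y hy => ?_, fun p hp =>
      (feasible_couple_iff (hmem p hp).1 (hmem p hp).2).2 (h p hp), hnc⟩
    obtain ⟨p, hp, hpy⟩ := hM.exists_mem_of_mem y ((hS y).2 hy)
    exact ⟨p, ⟨hp, hpy⟩, fun p' hp' => (hM.unique_of_nodup hnd).2 _ hp'.1 _ hp _ hp'.2 hpy⟩

/-- The number of couples of `N` consisting of two rows. -/
def rowCouples (N : Finset (Elt × Elt)) : ℕ :=
  (N.filter fun p => p.1.isLeft = true ∧ p.2.isLeft = true).card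

theorem couple_count {S : Cortege m n} {p : Elt × Elt} (h₁ : p.1 ∈ S.ground)
    (h₂ : p.2 ∈ S.ground) (hlt : cLT p.1 p.2) (h : S.coloring p.1 ≠ S.coloring p.2) :
    (if S.coloring p.1 = true then 1 else 0) +
      (if p.1.isLeft = true ∧ p.2.isLeft = true then 1 else 0) =
    (if sameSide p.1 p.2 ∧ numMin p ∈ S.whites then 1 else 0) +
      ((if p.1.isLeft = true ∧ S.coloring p.1 = true then 1 else 0) +
        (if p.2.isLeft = true ∧ S.coloring p.2 = true then 1 else 0)) := by
  obtain ⟨a, b⟩ := p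
  have hw₁ := Cortege.mem_whites_iff h₁
  have hw₂ := Cortege.mem_whites_iff h₂
  simp only at *
  rcases a with i | i <;> rcases b with j | j
  · have hij : i ≤ j := le_of_lt hlt
    simp only [numMin, eVal, Sum.elim_inl, id, hij, if_true, hw₁]
    cases hi : S.coloring (.inl i) <;> cases hj : S.coloring (.inl j) <;> simp_all [sameSide]
  · cases hi : S.coloring (.inl i) <;> simp_all [sameSide]
  · exact hlt.elim
  · have hij : ¬ i ≤ j := not_le_of_gt hlt
    simp only [numMin, eVal, Sum.elim_inr, id, hij, if_false, hw₂]
    cases hi : S.coloring (.inr i) <;> cases hj : S.coloring (.inr j) <;> simp_all [sameSide]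

theorem card_whiteRows {S : Cortege m n} {L : List Elt} (hnd : L.Nodup)
    (hS : ∀ a, a ∈ L ↔ a ∈ S.ground) :
    (L.map fun a => if a.isLeft = true ∧ S.coloring a = true then 1 else 0).sum =
      (S.I \ S.I').card := by
  rw [← List.sum_toFinset _ hnd, ← Finset.card_filter,
    ← Finset.card_image_of_injective (S.I \ S.I') (Sum.inl_injective (β := ℕ))]
  congr 1
  ext a
  simp only [Finset.mem_filter, List.mem_toFinset, hS]
  rcases a with i | j
  · rw [Cortege.inl_mem_ground]
    simp [Cortege.coloring]
    tauto
  · simp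

theorem matchWeight_coloring {K : Type*} [Field K] {q : K} {S : Cortege m n}
    {L : List Elt} {M : Multiset (Elt × Elt)} (hM : PlanarMatching L M) (hL : L.Pairwise cLT)
    (hnd : L.Nodup) (hS : ∀ a, a ∈ L ↔ a ∈ S.ground)
    (h : ∀ p ∈ M, S.coloring p.1 ≠ S.coloring p.2) :
    matchWeight q M S.coloring =
      q ^ ((zetaWhite S M.toFinset + (S.I \ S.I').card : ℤ) - rowCouples M.toFinset) := by
  have hval : M.toFinset.val = M := by
    rw [Multiset.toFinset_val, (hM.unique_of_nodup hnd).1.dedup]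
  have hmem : ∀ p ∈ M.toFinset, p.1 ∈ S.ground ∧ p.2 ∈ S.ground := fun p hp =>
    ⟨(hS _).1 (hM.mem_of_mem p (Multiset.mem_toFinset.1 hp)).1,
      (hS _).1 (hM.mem_of_mem p (Multiset.mem_toFinset.1 hp)).2⟩
  have hlt := (hM.noncrossing cLT_asymm hL).1
  have hw : matchWeight q M S.coloring =
      q ^ ∑ p ∈ M.toFinset, if S.coloring p.1 = true then 1 else 0 := by
    rw [← Finset.prod_pow_eq_pow_sum, Finset.prod, hval, matchWeight]
    congr 1
    refine Multiset.map_congr rfl fun p hp => ?_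
    have := h p hp
    cases h₁ : S.coloring p.1 <;> cases h₂ : S.coloring p.2 <;> simp_all
  have hsum := Finset.sum_congr rfl fun p hp => couple_count (hmem p hp).1 (hmem p hp).2
    (hlt p (Multiset.mem_toFinset.1 hp)) (h p (Multiset.mem_toFinset.1 hp))
  rw [Finset.sum_add_distrib, Finset.sum_add_distrib] at hsum
  have hI := hM.sum_map fun a => if a.isLeft = true ∧ S.coloring a = true then 1 else 0
  have hI' : (S.I \ S.I').card = ∑ p ∈ M.toFinset,
      ((if p.1.isLeft = true ∧ S.coloring p.1 = true then 1 else 0) +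
        (if p.2.isLeft = true ∧ S.coloring p.2 = true then 1 else 0)) := by
    rw [Finset.sum, hval, ← hI, card_whiteRows hnd hS]
  rw [hw, ← zpow_natCast]
  congr 1
  rw [rowCouples, zetaWhite, Finset.card_filter, Finset.card_filter, hI',
    eq_sub_iff_add_eq]
  exact_mod_cast hsum

theorem zetaWhite_sub_zetaWhite {S T : Cortege m n} {N : Finset (Elt × Elt)}
    (hS : IsFeasible S N) (hT : IsFeasible T N) (hST : S.ground = T.ground) :
    (zetaWhite S (differSet S T N) : ℤ) - zetaBlack S (differSet S T N) =
      zetaWhite S N - zetaWhite T N := by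
  simp only [zetaWhite, zetaBlack, differSet, Finset.filter_filter, Finset.card_filter]
  push_cast
  rw [← Finset.sum_sub_distrib, ← Finset.sum_sub_distrib]
  refine Finset.sum_congr rfl fun p hp => ?_
  have hg := hS.1 p hp
  have h₁ := (feasible_couple_iff hg.1 hg.2.1).1 (hS.2.2.1 p hp)
  have h₂ := (feasible_couple_iff (hST ▸ hg.1) (hST ▸ hg.2.1)).1 (hT.2.2.1 p hp)
  have hw₁ := Cortege.mem_whites_iff hg.1
  have hw₂ := Cortege.mem_whites_iff hg.2.1
  have hb₁ := Cortege.mem_blacks_iff hg.1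
  have hb₂ := Cortege.mem_blacks_iff hg.2.1
  have hw₁' := Cortege.mem_whites_iff (S := T) (hST ▸ hg.1)
  have hw₂' := Cortege.mem_whites_iff (S := T) (hST ▸ hg.2.1)
  rcases numMin_eq_or p with e | e <;> rw [e] <;>
    simp only [hw₁, hw₂, hb₁, hb₂, hw₁', hw₂', sameSide] <;>
    revert h₁ h₂ <;>
    cases S.coloring p.1 <;> cases S.coloring p.2 <;> cases T.coloring p.1 <;>
    cases T.coloring p.2 <;> cases p.1.isLeft <;> cases p.2.isLeft <;> simp

end Configurations

section Identity

theorem sort_filter {α : Type*} [LinearOrder α] (s : Finset α) (p : α → Prop) [DecidablePred p] :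
    (s.sort (· ≥ ·)).filter p = (s.filter p).sort (· ≥ ·) := by
  refine List.Perm.eq_of_pairwise' (r := (· ≥ ·)) ((s.pairwise_sort _).filter _)
    (Finset.pairwise_sort _ _) ?_
  rw [List.perm_ext_iff_of_nodup ((s.sort_nodup _).filter _) (Finset.sort_nodup _ _)]
  simp

theorem IsQMatrix.isQArray_extend {K : Type} [Field K] {A : Type} [Ring A] [Algebra K A] {q : K}
    {m n : ℕ} {x : ℕ → ℕ → A} (hx : IsQMatrix q m n x) :
    IsQArray q fun i j => if i ∈ Finset.Icc 1 m ∧ j ∈ Finset.Icc 1 n then x i j else 0 := by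
  obtain ⟨h₁, h₂, h₃, h₄⟩ := hx
  simp only [Finset.mem_Icc]
  constructor
  · intro i j k hjk
    by_cases h : (1 ≤ i ∧ i ≤ m) ∧ 1 ≤ j ∧ k ≤ n
    · rw [if_pos (by omega), if_pos (by omega), h₁ i j k] <;> omega
    · by_cases h' : (1 ≤ i ∧ i ≤ m) ∧ 1 ≤ j ∧ j ≤ n
      · rw [if_neg (c := (1 ≤ i ∧ i ≤ m) ∧ 1 ≤ k ∧ k ≤ n) (by omega)]; simp
      · rw [if_neg h']; simp
  · intro i l j hil
    by_cases h : (1 ≤ i ∧ l ≤ m) ∧ 1 ≤ j ∧ j ≤ n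
    · rw [if_pos (by omega), if_pos (by omega), h₂ i l j] <;> omega
    · by_cases h' : (1 ≤ i ∧ i ≤ m) ∧ 1 ≤ j ∧ j ≤ n
      · rw [if_neg (c := (1 ≤ l ∧ l ≤ m) ∧ 1 ≤ j ∧ j ≤ n) (by omega)]; simp
      · rw [if_neg h']; simp
  · intro i l j k hil hjk
    by_cases h : (1 ≤ i ∧ l ≤ m) ∧ 1 ≤ j ∧ k ≤ n
    · rw [if_pos (by omega), if_pos (by omega), h₃ i l j k] <;> omega
    · by_cases h' : (1 ≤ i ∧ i ≤ m) ∧ 1 ≤ k ∧ k ≤ n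
      · rw [if_neg (c := (1 ≤ l ∧ l ≤ m) ∧ 1 ≤ j ∧ j ≤ n) (by omega)]; simp
      · rw [if_neg h']; simp
  · intro i l j k hil hjk
    by_cases h : (1 ≤ i ∧ l ≤ m) ∧ 1 ≤ j ∧ k ≤ n
    · rw [if_pos (by omega), if_pos (by omega), if_pos (by omega), if_pos (by omega),
        h₄ i l j k] <;> omega
    · have e₁ : ¬ (((1 ≤ i ∧ i ≤ m) ∧ 1 ≤ j ∧ j ≤ n) ∧ (1 ≤ l ∧ l ≤ m) ∧ 1 ≤ k ∧ k ≤ n) := by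
        omega
      have e₂ : ¬ (((1 ≤ i ∧ i ≤ m) ∧ 1 ≤ k ∧ k ≤ n) ∧ (1 ≤ l ∧ l ≤ m) ∧ 1 ≤ j ∧ j ≤ n) := by
        omega
      rw [not_and_or] at e₁ e₂
      rcases e₁ with e₁ | e₁ <;> rcases e₂ with e₂ | e₂ <;> simp [if_neg e₁, if_neg e₂]

theorem qMinor_congr {K : Type} [Field K] {A : Type} [Ring A] [Algebra K A] (q : K)
    {x y : ℕ → ℕ → A} {I J : Finset ℕ} (h : ∀ i ∈ I, ∀ j ∈ J, x i j = y i j) :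
    qMinor q x I J = qMinor q y I J := by
  unfold qMinor
  split_ifs with hc
  · refine Finset.sum_congr rfl fun σ _ => ?_
    congr 3
    ext d
    exact h _ (I.orderEmbOfFin_mem _ _) _ (J.orderEmbOfFin_mem _ _)
  · rfl

namespace Cortege

variable {m n : ℕ}

/-- The rows lying in exactly one of `I` and `I'` in increasing order, followed by the columns
lying in exactly one of `J` and `J'` in decreasing order. -/
def groundList (S : Cortege m n) : List Elt :=
  (((S.I ∪ S.I').sort (· ≥ ·)).filter (· ∉ S.I ∩ S.I')).reverse.map Sum.inl ++
    colList ((S.J ∪ S.J') \ (S.J ∩ S.J'))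

theorem mem_groundList {S : Cortege m n} (a : Elt) : a ∈ S.groundList ↔ a ∈ S.ground := by
  rcases a with i | j
  · rw [inl_mem_ground]
    simp [groundList]
    tauto
  · rw [inr_mem_ground]
    simp [groundList]

theorem nodup_groundList (S : Cortege m n) : S.groundList.Nodup :=
  nodup_rows_append_columns (List.nodup_reverse.2 ((Finset.sort_nodup _ _).filter _))
    (Finset.sort_nodup _ _)

theorem pairwise_groundList (S : Cortege m n) : S.groundList.Pairwise cLT := by
  refine List.pairwise_append.2 ⟨?_, ?_, ?_⟩
  · rw [List.pairwise_map, List.pairwise_reverse]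
    exact (Finset.sortedGT_sort _).pairwise.filter _
  · rw [colList, List.pairwise_map]
    exact (Finset.sortedGT_sort _).pairwise
  · intro a ha b hb
    obtain ⟨i, -, rfl⟩ := List.mem_map.1 ha
    obtain ⟨j, -, rfl⟩ := mem_colList.1 hb
    trivial

/-- Two corteges have the same unions and the same intersections. -/
def SameSupport (S T : Cortege m n) : Prop :=
  S.I ∪ S.I' = T.I ∪ T.I' ∧ S.I ∩ S.I' = T.I ∩ T.I' ∧
    S.J ∪ S.J' = T.J ∪ T.J' ∧ S.J ∩ S.J' = T.J ∩ T.J'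

theorem SameSupport.groundList_eq {S T : Cortege m n} (h : SameSupport S T) :
    S.groundList = T.groundList := by
  obtain ⟨h₁, h₂, h₃, h₄⟩ := h
  rw [groundList, groundList, h₁, h₂, h₃, h₄]

theorem SameSupport.ground_eq {S T : Cortege m n} (h : SameSupport S T) :
    S.ground = T.ground := by
  ext a
  rw [← mem_groundList, h.groundList_eq, mem_groundList]

variable {K : Type} [Field K] {A : Type} [Ring A] [Algebra K A] {q : K} {x : ℕ → ℕ → A}

theorem coloredMinors_coloring (S : Cortege m n) :
    coloredMinors q x (S.I ∩ S.I') ((S.I ∪ S.I').sort (· ≥ ·))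
      (colsOf ((S.J ∪ S.J') \ (S.J ∩ S.J')) (S.J ∩ S.J') S.coloring false)
      (colsOf ((S.J ∪ S.J') \ (S.J ∩ S.J')) (S.J ∩ S.J') S.coloring true)
      (fun i => S.coloring (.inl i)) =
    q ^ (S.I \ S.I').card • (qMinor q x S.I S.J * qMinor q x S.I' S.J') := by
  have hJ : colsOf ((S.J ∪ S.J') \ (S.J ∩ S.J')) (S.J ∩ S.J') S.coloring false = S.J := by
    ext j
    simp [mem_colsOf, coloring]
    tauto
  have hJ' : colsOf ((S.J ∪ S.J') \ (S.J ∩ S.J')) (S.J ∩ S.J') S.coloring true = S.J' := by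
    ext j
    simp [mem_colsOf, coloring]
    tauto
  have hI : (S.I ∪ S.I').filter (fun i => i ∈ S.I ∩ S.I' ∨ S.coloring (.inl i) = true) = S.I := by
    ext i
    simp [coloring]
    tauto
  have hI' : (S.I ∪ S.I').filter (fun i => i ∈ S.I ∩ S.I' ∨ S.coloring (.inl i) = false) =
      S.I' := by
    ext i
    simp [coloring]
    tauto
  have hW : (S.I ∪ S.I').filter (fun i => i ∉ S.I ∩ S.I' ∧ S.coloring (.inl i) = true) =
      S.I \ S.I' := by
    ext i
    simp [coloring]
    tauto
  rw [coloredMinors, sort_filter, sort_filter, sort_filter, hJ, hJ', hI, hI', hW,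
    Finset.length_sort, qMinor_eq_listMinor q x S.hIJ, qMinor_eq_listMinor q x S.hI'J']

open Classical in
theorem exists_qMinor_mul_expansion (hq : q ≠ 0) (hx : IsQArray q x) (S₀ : Cortege m n) :
    ∃ D : Multiset (Elt × Elt) →₀ A, ∀ S : Cortege m n, SameSupport S S₀ →
      qMinor q x S.I S.J * qMinor q x S.I' S.J' = ∑ M ∈ D.support,
        (if IsFeasible S M.toFinset then
          q ^ ((zetaWhite S M.toFinset : ℤ) - rowCouples M.toFinset) else 0) • D M := by
  obtain ⟨D, hD, hsum⟩ := exists_finsupp_of_mem_planarSpan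
    (isPlanarFamily_coloredMinors hq hx (S₀.I ∩ S₀.I') ((S₀.I ∪ S₀.I').sort (· ≥ ·))
      (Finset.sortedGT_sort _).pairwise ((S₀.J ∪ S₀.J') \ (S₀.J ∩ S₀.J')) (S₀.J ∩ S₀.J')
      Finset.sdiff_disjoint)
  refine ⟨D, fun S hS => ?_⟩
  have hS' := hsum S.coloring
  rw [← hS.1, ← hS.2.1, ← hS.2.2.1, ← hS.2.2.2, coloredMinors_coloring, Finsupp.sum] at hS'
  rw [← inv_smul_smul₀ (pow_ne_zero (S.I \ S.I').card hq)
    (qMinor q x S.I S.J * qMinor q x S.I' S.J'), hS', Finset.smul_sum]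
  refine Finset.sum_congr rfl fun M hM => ?_
  have hMS : PlanarMatching S.groundList M := hS.groundList_eq ▸ hD M hM
  have hiff := isFeasible_toFinset_iff hMS S.pairwise_groundList S.nodup_groundList mem_groundList
  rw [smul_smul]
  congr 1
  split_ifs with hf
  · rw [matchWeight_coloring hMS S.pairwise_groundList S.nodup_groundList mem_groundList
      (hiff.1 hf), ← zpow_natCast, ← zpow_neg, ← zpow_add₀ hq]
    congr 1
    ring
  · rw [hiff, ← matchWeight_ne_zero_iff hq, not_not] at hf
    rw [hf, mul_zero]

end Cortege

open Classical in
theorem QBalanced.sum_feasible_eq {m n : ℕ} {ι κ : Type} [Fintype ι] [Fintype κ]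
    {F : ι → Cortege m n} {G : κ → Cortege m n} {α : ι → ℤ} {β : κ → ℤ}
    (hbal : QBalanced F G α β) (hFG : ∀ i k, (F i).ground = (G k).ground) {K : Type*} [Field K]
    {q : K} (hq : q ≠ 0) (N : Finset (Elt × Elt)) (r : ℤ) :
    ∑ i, q ^ α i * (if IsFeasible (F i) N then q ^ ((zetaWhite (F i) N : ℤ) - r) else 0) =
      ∑ k, q ^ β k * (if IsFeasible (G k) N then q ^ ((zetaWhite (G k) N : ℤ) - r) else 0) := by
  obtain ⟨γ, hγ⟩ := hbal
  simp only [mul_ite, mul_zero, ← Finset.sum_filter]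
  have hfeas (i : ι) (h : IsFeasible (F i) N) : IsFeasible (G (γ ⟨(i, N), h⟩).1.1) N := by
    have := (γ ⟨(i, N), h⟩).2
    rwa [(hγ ⟨(i, N), h⟩).1] at this
  refine Finset.sum_bij (fun i hi => (γ ⟨(i, N), (Finset.mem_filter.1 hi).2⟩).1.1) ?_ ?_ ?_ ?_
  · exact fun i hi => Finset.mem_filter.2 ⟨Finset.mem_univ _, hfeas i _⟩
  · intro i hi j hj h
    have := γ.injective (Subtype.ext (Prod.ext h ((hγ ⟨(i, N), (Finset.mem_filter.1 hi).2⟩).1.trans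
      (hγ ⟨(j, N), (Finset.mem_filter.1 hj).2⟩).1.symm)))
    exact congrArg (fun c => c.1.1) this
  · intro k hk
    have hk := (Finset.mem_filter.1 hk).2
    obtain ⟨⟨⟨i, N'⟩, hi⟩, hc⟩ := γ.surjective ⟨(k, N), hk⟩
    obtain rfl : N = N' := by
      have := (hγ ⟨(i, N'), hi⟩).1
      rw [hc] at this
      exact this
    exact ⟨i, Finset.mem_filter.2 ⟨Finset.mem_univ _, hi⟩, by rw [hc]⟩
  · intro i hi
    have hi := (Finset.mem_filter.1 hi).2
    obtain ⟨-, -, h⟩ := hγ ⟨(i, N), hi⟩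
    rw [zetaWhite_sub_zetaWhite hi (hfeas i hi) (hFG _ _)] at h
    rw [← zpow_add₀ hq, ← zpow_add₀ hq]
    congr 1
    linarith

end Identity

/-- Sufficiency of `q`-balancedness: every `q`-balanced quadruple yields a universal
quadratic identity for quantum minors of any `q`-matrix. -/
theorem universal_identity_of_qBalanced
    {m n : ℕ} (hm : 0 < m) (hn : 0 < n)
    {ι κ : Type} [Fintype ι] [Fintype κ]
    (F : ι → Cortege m n) (G : κ → Cortege m n)
    (hhom : Homogeneous F G)
    (α : ι → ℤ) (β : κ → ℤ)
    (hbal : QBalanced F G α β)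
    (K : Type) [Field K] (q : K) (hq : q ≠ 0)
    (A : Type) [Ring A] [Algebra K A]
    (x : ℕ → ℕ → A) (hx : IsQMatrix q m n x) :
    ∑ i, (q ^ α i) • (qMinor q x (F i).I (F i).J * qMinor q x (F i).I' (F i).J') =
      ∑ k, (q ^ β k) • (qMinor q x (G k).I (G k).J * qMinor q x (G k).I' (G k).J') := by
  classical
  by_cases hS₀ : ∃ S₀, (∃ i, F i = S₀) ∨ ∃ k, G k = S₀
  · obtain ⟨S₀, hS₀⟩ := hS₀
    obtain ⟨D, hD⟩ := Cortege.exists_qMinor_mul_expansion hq hx.isQArray_extend S₀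
    have key (S : Cortege m n) (hS : S.SameSupport S₀) := by
      have := hD S hS
      rwa [qMinor_congr q (y := x) (fun i hi j hj => if_pos ⟨S.hIm hi, S.hJn hj⟩),
        qMinor_congr q (y := x) (fun i hi j hj => if_pos ⟨S.hI'm hi, S.hJ'n hj⟩)] at this
    have hF (i : ι) := key (F i) (hhom _ _ (.inl ⟨i, rfl⟩) hS₀)
    have hG (k : κ) := key (G k) (hhom _ _ (.inr ⟨k, rfl⟩) hS₀)
    simp only [hF, hG, Finset.smul_sum, smul_smul]
    rw [Finset.sum_comm, Finset.sum_comm (s := Finset.univ (α := κ))]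
    refine Finset.sum_congr rfl fun M _ => ?_
    rw [← Finset.sum_smul, ← Finset.sum_smul, hbal.sum_feasible_eq (fun i k =>
      Cortege.SameSupport.ground_eq (hhom _ _ (.inl ⟨i, rfl⟩) (.inr ⟨k, rfl⟩))) hq]
  · have : IsEmpty ι := ⟨fun i => hS₀ ⟨_, .inl ⟨i, rfl⟩⟩⟩
    have : IsEmpty κ := ⟨fun k => hS₀ ⟨_, .inr ⟨k, rfl⟩⟩⟩
    simp
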